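/- Let m ∈ ℕ_{>0}, α > 0, t₁ > ⋯ > t_m ≥ 0 and u₁, …, u_m ∈ ℝ be fixed. For n ∈ ℕ_{>0} set r_ℓ := (1 − t_ℓ/n)^{1/2}, define ω_ℓ := e^{u_ℓ+⋯+u_m} − e^{u_{ℓ+1}+⋯+u_m} for 1 ≤ ℓ ≤ m−1, ω_m := e^{u_m} − 1, Ω := e^{u₁+⋯+u_m}, and 𝖳₀ := Σ_{ℓ=1}^m ω_ℓ t_ℓ^α. For x ∈ (0,1] define Σ₀(x) := Σ_{ℓ=1}^m ω_ℓ Q(α, t_ℓ x), Σ₁(x) := x^{α−1} Σ_{ℓ=1}^m ω_ℓ (e^{−t_ℓ x} t_ℓ^α / Γ(α)) · (1 − α − t_ℓ x)/2, f₀(x) := ln(1 + Σ₀(x)) and f₁(x) := Σ₁(x)/(1 + Σ₀(x)) (well defined since 1 + Σ₀(x) > 0). Let F_{n,j,ℓ} := I(r_ℓ², j, α), let M := n · (⌈n^{α/(2+α)}⌉)^{−1} (so M ≍ n^{2/(2+α)} and n/M ∈ ℕ), and set S₁ := Σ_{j=n/M}^{n} ln(1 + Σ_{ℓ=1}^m ω_ℓ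 F_{n,j,ℓ}). Then as n → ∞, S₁ = n·[ ∫₀¹ f₀(x) dx − (1/M) ln Ω + (𝖳₀/(Ω Γ(α+2))) M^{−α−1} ] + ∫₀¹ f₁(x) dx + (f₀(1) + ln Ω)/2 − ((2−α) 𝖳₀/(2 Ω Γ(α+1))) M^{−α} + O( n/M^{1+2α} + n/M^{2+α} + (1 + M^{1−α})/n ). -/

import Mathlib

open MeasureTheory Finset

/-- The incomplete Beta function `B(v, j, α) = ∫₀^v y^(j-1) (1-y)^(α-1) dy`. -/
noncomputable def incBeta (v : ℝ) (j : ℕ) (α : ℝ) : ℝ :=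
  ∫ y in (0:ℝ)..v, y ^ (j - 1) * (1 - y) ^ (α - 1)

/-- The normalized incomplete Beta function `I(v, j, α) = B(v, j, α)/B(j, α)`. -/
noncomputable def normIncBeta (v : ℝ) (j : ℕ) (α : ℝ) : ℝ := incBeta v j α / incBeta 1 j α

/-- The coefficient `ω_ℓ = e^{u_ℓ+⋯+u_m} − e^{u_{ℓ+1}+⋯+u_m}` (with `ω_m = e^{u_m} − 1`). -/
noncomputable def omegaCoef {m : ℕ} (u : Fin m → ℝ) (ℓ : Fin m) : ℝ :=
  Real.exp (∑ j ∈ Finset.Ici ℓ, u j) - Real.exp (∑ j ∈ Finset.Ioi ℓ, u j)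

/-- `Ω = e^{u₁+⋯+u_m}`. -/
noncomputable def OmegaTot {m : ℕ} (u : Fin m → ℝ) : ℝ := Real.exp (∑ j, u j)

/-- `𝖳₀ = Σ_ℓ ω_ℓ t_ℓ^α`. -/
noncomputable def Tzero {m : ℕ} (α : ℝ) (t u : Fin m → ℝ) : ℝ :=
  ∑ ℓ : Fin m, omegaCoef u ℓ * t ℓ ^ α

/-- The parameter `M = n · (⌈n^{α/(2+α)}⌉)⁻¹`, so that `n/M = ⌈n^{α/(2+α)}⌉ ∈ ℕ`. -/
noncomputable def Mpar (n : ℕ) (α : ℝ) : ℝ :=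
  (n : ℝ) * ((⌈(n : ℝ) ^ (α / (2 + α))⌉₊ : ℝ))⁻¹

/-- The upper incomplete Gamma function `Γ(a,x) = ∫_x^∞ s^(a-1) e^(-s) ds`. -/
noncomputable def incGamma (a x : ℝ) : ℝ := ∫ s in Set.Ioi x, s ^ (a - 1) * Real.exp (-s)

/-- The normalized incomplete Gamma function `Q(a,x) = Γ(a,x)/Γ(a)`. -/
noncomputable def Qfun (a x : ℝ) : ℝ := incGamma a x / Real.Gamma a

/-- `Σ₀(x) = Σ_ℓ ω_ℓ Q(α, t_ℓ x)`. -/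
noncomputable def SigmaZero {m : ℕ} (α : ℝ) (t u : Fin m → ℝ) (x : ℝ) : ℝ :=
  ∑ ℓ : Fin m, omegaCoef u ℓ * Qfun α (t ℓ * x)

/-- `Σ₁(x) = x^{α−1} Σ_ℓ ω_ℓ (e^{−t_ℓ x} t_ℓ^α / Γ(α)) (1 − α − t_ℓ x)/2`. -/
noncomputable def SigmaOne {m : ℕ} (α : ℝ) (t u : Fin m → ℝ) (x : ℝ) : ℝ :=
  x ^ (α - 1) * ∑ ℓ : Fin m,
    omegaCoef u ℓ * (Real.exp (-(t ℓ * x)) * t ℓ ^ α / Real.Gamma α) * ((1 - α - t ℓ * x) / 2)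

/-- `f₀(x) = ln(1 + Σ₀(x))`. -/
noncomputable def fZero {m : ℕ} (α : ℝ) (t u : Fin m → ℝ) (x : ℝ) : ℝ :=
  Real.log (1 + SigmaZero α t u x)

/-- `f₁(x) = Σ₁(x)/(1 + Σ₀(x))`. -/
noncomputable def fOne {m : ℕ} (α : ℝ) (t u : Fin m → ℝ) (x : ℝ) : ℝ :=
  SigmaOne α t u x / (1 + SigmaZero α t u x)

/-- An envelope for the error terms: `|α - 1| x^(α-2) + 1`. Its first summand is the derivative
of `± x^(α-1)`, so that the sums of its values on a grid show no logarithm at `α = 1`. -/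
noncomputable def envelope (α x : ℝ) : ℝ := |α - 1| * x ^ (α - 2) + 1

lemma one_le_envelope (α : ℝ) {x : ℝ} (hx : 0 < x) : 1 ≤ envelope α x := by
  unfold envelope
  have : 0 ≤ |α - 1| * x ^ (α - 2) := by positivity
  linarith

lemma envelope_pos (α : ℝ) {x : ℝ} (hx : 0 < x) : 0 < envelope α x :=
  lt_of_lt_of_le one_pos (one_le_envelope α hx)

lemma exists_rpow_le_envelope {α β : ℝ} (h : α - 2 ≤ β) (h1 : 1 ≤ α → 0 ≤ β) :
    ∃ C : ℝ, 0 < C ∧ ∀ x : ℝ, 0 < x → x ≤ 1 → x ^ β ≤ C * envelope α x := by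
  by_cases hα : 1 ≤ α
  · refine ⟨1, one_pos, fun x hx hx1 => ?_⟩
    rw [one_mul]
    exact (Real.rpow_le_one hx.le hx1 (h1 hα)).trans (one_le_envelope α hx)
  · have hα' : 0 < |α - 1| := abs_pos.2 (by linarith)
    refine ⟨|α - 1|⁻¹, by positivity, fun x hx hx1 => ?_⟩
    calc x ^ β ≤ x ^ (α - 2) := Real.rpow_le_rpow_of_exponent_ge hx hx1 h
      _ = |α - 1|⁻¹ * (|α - 1| * x ^ (α - 2)) := by field_simp
      _ ≤ _ := by
        unfold envelope
        gcongr
        linarith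

lemma rpow_le_two_rpow_abs_mul {a x β : ℝ} (ha : 0 < a) (hax : a ≤ x) (hxa : x ≤ 2 * a) :
    x ^ β ≤ 2 ^ |β| * a ^ β ∧ a ^ β ≤ 2 ^ |β| * x ^ β := by
  have hx : 0 < x := ha.trans_le hax
  have h1 : (1:ℝ) ≤ 2 ^ |β| := Real.one_le_rpow (by norm_num) (abs_nonneg β)
  rcases le_total 0 β with hβ | hβ
  · rw [abs_of_nonneg hβ] at *
    constructor
    · rw [← Real.mul_rpow (by norm_num) ha.le]
      exact Real.rpow_le_rpow hx.le hxa hβ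
    · calc a ^ β ≤ x ^ β := Real.rpow_le_rpow ha.le hax hβ
        _ ≤ _ := le_mul_of_one_le_left (by positivity) h1
  · constructor
    · calc x ^ β ≤ a ^ β := Real.rpow_le_rpow_of_nonpos ha hax hβ
        _ ≤ _ := le_mul_of_one_le_left (by positivity) h1
    · have : (2 * a) ^ β ≤ x ^ β := Real.rpow_le_rpow_of_nonpos hx hxa hβ
      rw [Real.mul_rpow (by norm_num) ha.le] at this
      rw [abs_of_nonpos hβ, Real.rpow_neg (by norm_num)]
      have h2 : (0:ℝ) < 2 ^ β := by positivity
      rw [inv_mul_eq_div, le_div_iff₀ h2]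
      linarith

lemma envelope_le_two_rpow_abs_mul {α a x : ℝ} (ha : 0 < a) (hax : a ≤ x) (hxa : x ≤ 2 * a) :
    envelope α x ≤ 2 ^ |α - 2| * envelope α a := by
  have h := (rpow_le_two_rpow_abs_mul (β := α - 2) ha hax hxa).1
  have h1 : (1:ℝ) ≤ 2 ^ |α - 2| := Real.one_le_rpow (by norm_num) (abs_nonneg _)
  unfold envelope
  nlinarith [abs_nonneg (α - 1), mul_le_mul_of_nonneg_left h (abs_nonneg (α - 1))]

lemma abs_mul_rpow_le_abs_sub {α a b : ℝ} (ha : 0 < a) (hab : a < b) (hba : b ≤ 2 * a) :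
    |α - 1| * a ^ (α - 2) * (b - a) ≤ 2 ^ |α - 2| * |b ^ (α - 1) - a ^ (α - 1)| := by
  obtain ⟨ξ, hξ, e⟩ := exists_hasDerivAt_eq_slope (fun x : ℝ => x ^ (α - 1))
    (fun x => (α - 1) * x ^ (α - 1 - 1)) hab
    (fun x hx => (Real.continuousAt_rpow_const x _ (Or.inl (ha.trans_le hx.1).ne')).continuousWithinAt)
    (fun x hx => Real.hasDerivAt_rpow_const (Or.inl (ha.trans hx.1).ne'))
  have hba' : 0 < b - a := sub_pos.2 hab
  rw [eq_div_iff hba'.ne'] at e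
  rw [← e, abs_mul, abs_mul, abs_of_pos hba', abs_of_pos (Real.rpow_pos_of_pos (ha.trans hξ.1) _),
    show α - 1 - 1 = α - 2 by ring]
  have h := (rpow_le_two_rpow_abs_mul (β := α - 2) ha hξ.1.le (hξ.2.le.trans hba)).2
  calc |α - 1| * a ^ (α - 2) * (b - a)
      ≤ |α - 1| * (2 ^ |α - 2| * ξ ^ (α - 2)) * (b - a) := by gcongr
    _ = _ := by ring

lemma sum_abs_sub_rpow_le (γ : ℝ) {x : ℕ → ℝ}
    {N n : ℕ} (hN : N ≤ n) (hpos : ∀ j, N ≤ j → 0 < x j) (hmono : Monotone x) :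
    ∑ j ∈ Finset.Icc N n, |x (j + 1) ^ γ - x j ^ γ| ≤ x (n + 1) ^ γ + x N ^ γ := by
  have htel : ∑ j ∈ Finset.Icc N n, (x (j + 1) ^ γ - x j ^ γ) = x (n + 1) ^ γ - x N ^ γ := by
    rw [← Finset.Ico_add_one_right_eq_Icc, Finset.sum_Ico_eq_sum_range]
    have := Finset.sum_range_sub (fun i => x (N + i) ^ γ) (n + 1 - N)
    simp only [← add_assoc] at this
    rw [this]
    congr 3
    omega
  have hN0 : 0 ≤ x N ^ γ := (Real.rpow_pos_of_pos (hpos N le_rfl) _).le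
  have hn0 : 0 ≤ x (n + 1) ^ γ := (Real.rpow_pos_of_pos (hpos (n + 1) (by omega)) _).le
  rcases le_total 0 γ with hγ | hγ
  · rw [Finset.sum_congr rfl (fun j hj => abs_of_nonneg (sub_nonneg.2
      (Real.rpow_le_rpow (hpos j (Finset.mem_Icc.1 hj).1).le (hmono (Nat.le_succ j)) hγ))), htel]
    linarith
  · rw [Finset.sum_congr rfl (fun j hj => abs_of_nonpos (sub_nonpos.2
      (Real.rpow_le_rpow_of_nonpos (hpos j (Finset.mem_Icc.1 hj).1) (hmono (Nat.le_succ j)) hγ))),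
      Finset.sum_neg_distrib, htel]
    linarith

lemma exists_sum_envelope_le (α : ℝ) :
    ∃ C : ℝ, 0 < C ∧ ∀ n N : ℕ, 1 ≤ N → N ≤ n →
      ∑ j ∈ Finset.Icc N n, envelope α ((j:ℝ) / n) ≤ C * (n * (1 + ((N:ℝ) / n) ^ (α - 1))) := by
  refine ⟨2 ^ |α - 2| * 2 ^ |α - 1| + 2 ^ |α - 2| + 1, by positivity, fun n N hN hNn => ?_⟩
  have hn : (0:ℝ) < n := by exact_mod_cast (show 0 < n by omega)
  have hN' : (0:ℝ) < N := by exact_mod_cast (show 0 < N by omega)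
  have hterm : ∀ j ∈ Finset.Icc N n, |α - 1| * ((j:ℝ) / n) ^ (α - 2) ≤
      n * (2 ^ |α - 2| * |(((j + 1 : ℕ):ℝ) / n) ^ (α - 1) - ((j:ℝ) / n) ^ (α - 1)|) := by
    intro j hj
    have hj1 : (1:ℝ) ≤ j := by exact_mod_cast hN.trans (Finset.mem_Icc.1 hj).1
    have h := abs_mul_rpow_le_abs_sub (α := α) (a := (j:ℝ) / n) (b := ((j + 1 : ℕ):ℝ) / n)
      (by positivity) (by push_cast; gcongr; linarith)
      (by push_cast; rw [← mul_div_assoc]; gcongr; linarith)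
    rw [← div_le_iff₀' hn]
    refine le_trans (le_of_eq ?_) h
    push_cast
    field_simp
    ring
  have hsum := sum_abs_sub_rpow_le (α - 1) (x := fun j : ℕ => (j:ℝ) / n)
    hNn (fun j hj => div_pos (by exact_mod_cast (show 0 < j by omega)) hn)
    (fun a b hab => by simp only; gcongr)
  have hlast : (((n + 1 : ℕ):ℝ) / n) ^ (α - 1) ≤ 2 ^ |α - 1| := by
    have h1n : (1:ℝ) ≤ n := by exact_mod_cast hN.trans hNn
    have := (rpow_le_two_rpow_abs_mul (β := α - 1) (a := 1) (x := ((n + 1 : ℕ):ℝ) / n) one_pos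
      (by rw [le_div_iff₀ hn]; push_cast; linarith)
      (by rw [div_le_iff₀ hn]; push_cast; linarith)).1
    simpa using this
  have hcard : ∑ j ∈ Finset.Icc N n, (1:ℝ) ≤ n := by
    simp only [Finset.sum_const, Nat.card_Icc, nsmul_eq_mul, mul_one]
    exact_mod_cast (show n + 1 - N ≤ n by omega)
  have hNn0 : 0 < ((N:ℝ) / n) ^ (α - 1) := by positivity
  calc ∑ j ∈ Finset.Icc N n, envelope α ((j:ℝ) / n)
      = ∑ j ∈ Finset.Icc N n, |α - 1| * ((j:ℝ) / n) ^ (α - 2) + ∑ j ∈ Finset.Icc N n, (1:ℝ) := by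
        simp only [envelope, Finset.sum_add_distrib]
    _ ≤ n * (2 ^ |α - 2| * (2 ^ |α - 1| + ((N:ℝ) / n) ^ (α - 1))) + n := by
        refine add_le_add ((Finset.sum_le_sum hterm).trans ?_) hcard
        rw [← Finset.mul_sum, ← Finset.mul_sum]
        gcongr
        exact hsum.trans (by gcongr)
    _ ≤ _ := by
        have h0 : 0 ≤ (n:ℝ) * ((2 ^ |α - 2| * 2 ^ |α - 1| + 1) * ((N:ℝ) / n) ^ (α - 1)
          + 2 ^ |α - 2|) := by positivity
        linarith

lemma abs_exp_sub_one_sub_id_le_mul_exp (x : ℝ) :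
    |Real.exp x - 1 - x| ≤ x ^ 2 * Real.exp |x| := by
  have h := Complex.norm_exp_sub_sum_le_norm_mul_exp (x : ℂ) 2
  have e : Complex.exp (x : ℂ) - ∑ m ∈ Finset.range 2, (x : ℂ) ^ m / (m.factorial : ℂ)
      = ((Real.exp x - 1 - x : ℝ) : ℂ) := by
    simp [Finset.sum_range_succ]; ring
  rw [e, Complex.norm_real, Complex.norm_real, Real.norm_eq_abs, Real.norm_eq_abs, sq_abs] at h
  exact h

lemma abs_log_one_add_sub_le {y : ℝ} (hy : 0 ≤ y) :
    |Real.log (1 + y) - y + y ^ 2 / 2| ≤ y ^ 3 := by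
  have h := (convex_Icc (0:ℝ) y).norm_image_sub_le_of_norm_hasDerivWithin_le
    (f := fun x => Real.log (1 + x) - x + x ^ 2 / 2) (f' := fun x => 1 / (1 + x) - 1 + x)
    (C := y ^ 2) (x := 0) (y := y) ?_ ?_ ⟨le_rfl, hy⟩ ⟨hy, le_rfl⟩
  · simp only [Real.norm_eq_abs, sub_zero, abs_of_nonneg hy] at h
    simpa [pow_succ] using h
  · intro x hx
    have h1 : HasDerivAt (fun x : ℝ => 1 + x) 1 x := by simpa using (hasDerivAt_id x).const_add 1
    have h2 := ((h1.log (by linarith [hx.1])).sub (hasDerivAt_id x)).add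
      ((hasDerivAt_pow 2 x).div_const 2)
    exact (h2.congr_deriv (by simp)).hasDerivWithinAt
  · intro x hx
    have hx0 := hx.1
    have : 1 / (1 + x) - 1 + x = x ^ 2 / (1 + x) := by field_simp; ring
    rw [this, Real.norm_eq_abs, abs_of_nonneg (by positivity)]
    calc x ^ 2 / (1 + x) ≤ x ^ 2 := div_le_self (sq_nonneg x) (by linarith)
      _ ≤ y ^ 2 := by gcongr; exact hx.2

/-- If the increments of a null sequence are `O(j⁻³)`, the sequence is `O(j⁻²)`. -/
lemma abs_le_of_increment_le_inv_cube {g : ℕ → ℝ} {C : ℝ} (hC : 0 ≤ C)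
    (hg : ∀ j : ℕ, 1 ≤ j → |g (j + 1) - g j| ≤ C / (j : ℝ) ^ 3)
    (hlim : Filter.Tendsto g Filter.atTop (nhds 0)) (j : ℕ) (hj : 1 ≤ j) :
    |g j| ≤ 4 * C / (j : ℝ) ^ 2 := by
  have hstep : ∀ k : ℕ, 1 ≤ k →
      C / (k : ℝ) ^ 3 ≤ 4 * C / (k : ℝ) ^ 2 - 4 * C / ((k + 1 : ℕ) : ℝ) ^ 2 := by
    intro k hk
    have hk' : (1:ℝ) ≤ k := by exact_mod_cast hk
    push_cast
    have : 4 * C / (k : ℝ) ^ 2 - 4 * C / ((k : ℝ) + 1) ^ 2 - C / (k : ℝ) ^ 3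
        = C * ((7 * k ^ 2 + 2 * k - 1) / (k ^ 3 * (k + 1) ^ 2)) := by
      field_simp; ring
    have h2 : 0 ≤ (7 * (k:ℝ) ^ 2 + 2 * k - 1) / (k ^ 3 * (k + 1) ^ 2) := by
      apply div_nonneg _ (by positivity)
      nlinarith
    nlinarith [mul_nonneg hC h2]
  have hinv : Filter.Tendsto (fun k : ℕ => 4 * C / ((k + 1 : ℕ) : ℝ) ^ 2) Filter.atTop (nhds 0) := by
    apply Filter.Tendsto.const_div_atTop
    exact (Filter.tendsto_pow_atTop two_ne_zero).comp
      (tendsto_natCast_atTop_atTop.comp (Filter.tendsto_add_atTop_nat 1))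
  have hlim' := hlim.comp (Filter.tendsto_add_atTop_nat 1)
  obtain ⟨i, rfl⟩ : ∃ i, j = i + 1 := ⟨j - 1, by omega⟩
  rw [abs_le]
  constructor
  · have hanti : Antitone (fun k : ℕ => g (k + 1) + 4 * C / ((k + 1 : ℕ) : ℝ) ^ 2) := by
      apply antitone_nat_of_succ_le
      intro k
      have h1 := (abs_le.1 (hg (k + 1) (by omega))).2
      have h2 := hstep (k + 1) (by omega)
      linarith
    have := hanti.le_of_tendsto (by simpa using hlim'.add hinv) i
    linarith
  · have hmono : Monotone (fun k : ℕ => g (k + 1) - 4 * C / ((k + 1 : ℕ) : ℝ) ^ 2) := by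
      apply monotone_nat_of_le_succ
      intro k
      have h1 := (abs_le.1 (hg (k + 1) (by omega))).1
      have h2 := hstep (k + 1) (by omega)
      linarith
    have := hmono.ge_of_tendsto (by simpa using hlim'.sub hinv) i
    linarith

/-- The ratio `Γ(j+α) / (Γ(j) j^α)`. -/
noncomputable def gammaRatio (α : ℝ) (j : ℕ) : ℝ :=
  Real.Gamma (j + α) / (Real.Gamma j * (j : ℝ) ^ α)

lemma gammaRatio_pos {α : ℝ} (hα : 0 < α) {j : ℕ} (hj : 1 ≤ j) : 0 < gammaRatio α j := by
  have hj' : (0:ℝ) < j := by exact_mod_cast hj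
  have := Real.Gamma_pos_of_pos hj'
  have := Real.Gamma_pos_of_pos (show 0 < (j:ℝ) + α by linarith)
  unfold gammaRatio
  positivity

lemma log_gammaRatio_succ_sub {α : ℝ} (hα : 0 < α) {j : ℕ} (hj : 1 ≤ j) :
    Real.log (gammaRatio α (j + 1)) - Real.log (gammaRatio α j)
      = Real.log (1 + α / j) - α * Real.log (1 + 1 / j) := by
  have hj' : (0:ℝ) < j := by exact_mod_cast hj
  have h1 := Real.Gamma_pos_of_pos hj'
  have h2 := Real.Gamma_pos_of_pos (show 0 < (j:ℝ) + α by linarith)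
  have e : gammaRatio α (j + 1) = gammaRatio α j * ((1 + α / j) / (1 + 1 / j) ^ α) := by
    unfold gammaRatio
    have e1 : ((j + 1 : ℕ) : ℝ) + α = (j + α) + 1 := by push_cast; ring
    have e2 : (1 + 1 / (j:ℝ)) ^ α = ((j + 1 : ℕ) : ℝ) ^ α / (j:ℝ) ^ α := by
      rw [← Real.div_rpow (by positivity) hj'.le]
      congr 1; push_cast; field_simp
    rw [e1, Real.Gamma_add_one (by positivity), e2]
    push_cast
    rw [Real.Gamma_add_one hj'.ne']
    have : 0 < (j:ℝ) ^ α := by positivity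
    have : 0 < ((j:ℝ) + 1) ^ α := by positivity
    field_simp
  rw [e, Real.log_mul (gammaRatio_pos hα hj).ne' (by positivity), Real.log_div (by positivity)
    (by positivity), Real.log_rpow (by positivity)]
  ring

lemma prod_add_natCast_eq_Gamma_div {α : ℝ} (hα : 0 < α) (n : ℕ) :
    ∏ j ∈ Finset.range n, (α + j) = Real.Gamma (n + α) / Real.Gamma α := by
  have h0 := Real.Gamma_pos_of_pos hα
  induction n with
  | zero => simp [h0.ne']
  | succ k ih =>
    rw [Finset.prod_range_succ, ih]
    have : ((k + 1 : ℕ) : ℝ) + α = (k + α) + 1 := by push_cast; ring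
    rw [this, Real.Gamma_add_one (by positivity)]
    ring

lemma tendsto_gammaRatio {α : ℝ} (hα : 0 < α) :
    Filter.Tendsto (gammaRatio α) Filter.atTop (nhds 1) := by
  have h0 := Real.Gamma_pos_of_pos hα
  have h := (Real.GammaSeq_tendsto_Gamma α)
  have h1 : Filter.Tendsto (fun n : ℕ => Real.Gamma α / Real.GammaSeq α n * ((n : ℝ) / (n + α)))
      Filter.atTop (nhds 1) := by
    have h2 : Filter.Tendsto (fun n : ℕ => (n : ℝ) / (n + α)) Filter.atTop (nhds 1) :=
      tendsto_natCast_div_add_atTop α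
    simpa [h0.ne'] using ((tendsto_const_nhds (x := Real.Gamma α)).div h h0.ne').mul h2
  refine h1.congr' ?_
  filter_upwards [Filter.eventually_ge_atTop 1] with n hn
  have hn' : (0:ℝ) < n := by exact_mod_cast hn
  have h2 := Real.Gamma_pos_of_pos (show 0 < (n:ℝ) + α by linarith)
  have h3 := Real.Gamma_pos_of_pos hn'
  unfold Real.GammaSeq gammaRatio
  rw [Finset.prod_range_succ, prod_add_natCast_eq_Gamma_div hα, ← Real.Gamma_nat_eq_factorial,
    Real.Gamma_add_one hn'.ne']
  have : 0 < (n:ℝ) ^ α := by positivity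
  field_simp
  ring

lemma exists_abs_gammaRatio_sub_le {α : ℝ} (hα : 0 < α) :
    ∃ K : ℝ, 0 ≤ K ∧ ∀ j : ℕ, 1 ≤ j →
      |gammaRatio α j - 1 - α * (α - 1) / 2 / j| ≤ K * |α - 1| / (j : ℝ) ^ 2 := by
  by_cases h1 : α = 1
  · refine ⟨0, le_rfl, fun j hj => ?_⟩
    have hj' : (0:ℝ) < j := by exact_mod_cast hj
    have := Real.Gamma_pos_of_pos hj'
    simp [gammaRatio, h1, Real.Gamma_add_one hj'.ne']
    rw [mul_comm, div_self (by positivity), sub_self]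
  set c := α * (α - 1) / 2 with hc
  set L : ℕ → ℝ := fun j => Real.log (gammaRatio α j) with hL
  set D := α ^ 3 + α + |c| with hD
  have hD0 : 0 ≤ D := by positivity
  have hincr : ∀ j : ℕ, 1 ≤ j →
      |(L (j + 1) - c / ((j + 1 : ℕ) : ℝ)) - (L j - c / (j:ℝ))| ≤ D / (j : ℝ) ^ 3 := by
    intro j hj
    have hj' : (1:ℝ) ≤ j := by exact_mod_cast hj
    have hj0 : (0:ℝ) < j := by linarith
    have e := log_gammaRatio_succ_sub hα hj
    have a1 := abs_log_one_add_sub_le (y := α / j) (by positivity)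
    have a2 := abs_log_one_add_sub_le (y := 1 / j) (by positivity)
    have e2 : (L (j + 1) - c / ((j + 1 : ℕ) : ℝ)) - (L j - c / (j:ℝ))
        = (Real.log (1 + α / j) - α / j + (α / j) ^ 2 / 2)
          - α * (Real.log (1 + 1 / j) - 1 / j + (1 / j) ^ 2 / 2)
          - c * (1 / (j ^ 2 * (j + 1))) := by
      have : L (j + 1) - L j = _ := e
      have e3 : c / ((j + 1 : ℕ) : ℝ) - c / (j:ℝ) = - c * (1 / (j * (j + 1))) := by
        push_cast; field_simp; ring
      have e4 : (α / (j:ℝ)) ^ 2 / 2 - α * ((1 / j) ^ 2 / 2) = c * (1 / j^2) := by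
        rw [hc]; field_simp
      have e5 : c * (1 / ((j:ℝ) * (j + 1))) = c * (1 / j^2) - c * (1 / (j ^ 2 * (j + 1))) := by
        field_simp; ring
      have e6 : α / (j:ℝ) = α * (1 / j) := by ring
      linarith
    rw [e2]
    have a3 : |c * (1 / ((j:ℝ) ^ 2 * (j + 1)))| ≤ |c| * (1 / (j:ℝ) ^ 3) := by
      rw [abs_mul, abs_of_pos (show 0 < 1 / ((j:ℝ) ^ 2 * (j + 1)) by positivity)]
      gcongr
      nlinarith [sq_nonneg (j:ℝ)]
    have a4 : |α * (Real.log (1 + 1 / j) - 1 / j + (1 / j) ^ 2 / 2)| ≤ α * (1 / (j:ℝ)) ^ 3 := by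
      rw [abs_mul, abs_of_pos hα]; gcongr
    calc _ ≤ (α / j) ^ 3 + α * (1 / (j:ℝ)) ^ 3 + |c| * (1 / (j:ℝ) ^ 3) :=
          (abs_sub _ _).trans (add_le_add ((abs_sub _ _).trans (add_le_add a1 a4)) a3)
      _ = _ := by rw [hD]; field_simp
  have hlimL : Filter.Tendsto L Filter.atTop (nhds 0) := by
    simpa using (tendsto_gammaRatio hα).log one_ne_zero
  have hg := abs_le_of_increment_le_inv_cube (g := fun j => L j - c / (j:ℝ)) hD0 hincr
    (by simpa using hlimL.sub (tendsto_const_div_atTop_nhds_zero_nat c))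
  set B := |c| + 4 * D with hB
  have hB0 : 0 ≤ B := by positivity
  refine ⟨(B ^ 2 * Real.exp B + 4 * D) / |α - 1|, by positivity, fun j hj => ?_⟩
  have hj' : (1:ℝ) ≤ j := by exact_mod_cast hj
  have hj0 : (0:ℝ) < j := by linarith
  rw [div_mul_cancel₀ _ (abs_ne_zero.2 (sub_ne_zero.2 h1))]
  have g1 : |L j - c / j| ≤ 4 * D / (j:ℝ) ^ 2 := hg j hj
  have hLj : |L j| ≤ B / j := by
    have : L j = (L j - c / j) + c / j := by ring
    rw [this]
    calc _ ≤ 4 * D / (j:ℝ) ^ 2 + |c| / j := by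
          refine (abs_add_le _ _).trans (add_le_add g1 ?_)
          rw [abs_div, abs_of_pos hj0]
      _ ≤ 4 * D / j + |c| / j := by
          gcongr; nlinarith
      _ = B / j := by rw [hB]; ring
  have hLB : |L j| ≤ B := hLj.trans (div_le_self hB0 hj')
  have e : gammaRatio α j = Real.exp (L j) := (Real.exp_log (gammaRatio_pos hα hj)).symm
  rw [e]
  calc |Real.exp (L j) - 1 - c / j| = |(Real.exp (L j) - 1 - L j) + (L j - c / j)| := by ring_nf
    _ ≤ (B / j) ^ 2 * Real.exp B + 4 * D / (j:ℝ) ^ 2 := by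
        refine (abs_add_le _ _).trans (add_le_add ((abs_exp_sub_one_sub_id_le_mul_exp _).trans ?_) g1)
        rw [← sq_abs]; gcongr
    _ = _ := by field_simp

lemma exists_abs_one_sub_div_pow_sub_le {T : ℝ} (hT : 0 ≤ T) :
    ∃ C : ℝ, 0 ≤ C ∧ ∀ (j : ℕ) (s : ℝ), 1 ≤ j → 0 ≤ s → s ≤ T → 2 * s ≤ j →
      |(1 - s / j) ^ (j - 1) - Real.exp (-s) * (1 + (s - s ^ 2 / 2) / j)|
        ≤ C * s ^ 2 / (j : ℝ) ^ 2 := by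
  set B := 1 + T + (1 / 2 + 2 * T) with hB
  refine ⟨B ^ 2 * Real.exp B + (1 / 2 + 2 * T), by positivity, fun j s hj hs hsT hsj => ?_⟩
  have hj1 : (1:ℝ) ≤ j := by exact_mod_cast hj
  have hj0 : (0:ℝ) < j := by linarith
  set w := s / j with hw
  have hw0 : 0 ≤ w := by positivity
  have hw1 : w ≤ 1 / 2 := by rw [hw, div_le_iff₀ hj0]; linarith
  have hsw : s = j * w := by rw [hw]; field_simp
  set r := Real.log (1 - w) + w + w ^ 2 / 2 with hr
  have hr' : |r| ≤ 2 * w ^ 3 := by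
    have h := Real.abs_log_sub_add_sum_range_le (x := w) (by rw [abs_of_nonneg hw0]; linarith) 2
    rw [abs_of_nonneg hw0] at h
    have e : (∑ i ∈ range 2, w ^ (i + 1) / ((i:ℝ) + 1)) + Real.log (1 - w) = r := by
      rw [hr]; simp [Finset.sum_range_succ]; ring
    rw [e] at h
    refine h.trans ?_
    rw [div_le_iff₀ (by linarith)]
    have : 0 ≤ w ^ 3 := by positivity
    norm_num
    nlinarith
  set η := w ^ 2 / 2 + (j - 1) * r with hη
  have hη' : |η| ≤ (1 / 2 + 2 * T) * w ^ 2 := by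
    have h1 : |((j:ℝ) - 1) * r| ≤ j * (2 * w ^ 3) := by
      rw [abs_mul, abs_of_nonneg (by linarith)]
      gcongr
      linarith
    calc |η| ≤ w ^ 2 / 2 + j * (2 * w ^ 3) := by
          refine (abs_add_le _ _).trans (add_le_add ?_ h1)
          rw [abs_of_nonneg (by positivity)]
      _ = (1 / 2 + 2 * s) * w ^ 2 := by rw [hsw]; ring
      _ ≤ _ := by gcongr
  set δ := (s - s ^ 2 / 2) / j + η with hδ
  have hδ' : |δ| ≤ B * w := by
    have h1 : |(s - s ^ 2 / 2) / j| ≤ (1 + T) * w := by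
      have : (s - s ^ 2 / 2) / j = (1 - s / 2) * w := by rw [hw]; ring
      rw [this, abs_mul, abs_of_nonneg hw0]
      gcongr
      rw [abs_le]; constructor <;> linarith
    calc |δ| ≤ (1 + T) * w + (1 / 2 + 2 * T) * w ^ 2 := (abs_add_le _ _).trans (add_le_add h1 hη')
      _ ≤ (1 + T) * w + (1 / 2 + 2 * T) * w := by
          gcongr; nlinarith
      _ = B * w := by rw [hB]; ring
  have hδB : |δ| ≤ B := hδ'.trans (mul_le_of_le_one_right (by positivity) (by linarith))
  have e : (1 - w) ^ (j - 1) = Real.exp (-s) * Real.exp δ := by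
    rw [← Real.exp_add]
    have : -s + δ = ((j - 1 : ℕ) : ℝ) * Real.log (1 - w) := by
      rw [Nat.cast_sub hj, hδ, hη, hr, hsw]
      push_cast
      field_simp
      ring
    rw [this, Real.exp_nat_mul, Real.exp_log (by linarith)]
  rw [e, ← mul_sub, abs_mul, abs_of_pos (Real.exp_pos _)]
  have hes : Real.exp (-s) ≤ 1 := Real.exp_le_one_iff.2 (by linarith)
  have hmain : |Real.exp δ - (1 + (s - s ^ 2 / 2) / j)|
      ≤ (B ^ 2 * Real.exp B + (1 / 2 + 2 * T)) * w ^ 2 := by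
    calc |Real.exp δ - (1 + (s - s ^ 2 / 2) / j)| = |(Real.exp δ - 1 - δ) + η| := by
          congr 1; rw [hδ]; ring
      _ ≤ (B * w) ^ 2 * Real.exp B + (1 / 2 + 2 * T) * w ^ 2 := by
          refine (abs_add_le _ _).trans
            (add_le_add ((abs_exp_sub_one_sub_id_le_mul_exp _).trans ?_) hη')
          rw [← sq_abs]; gcongr
      _ = _ := by ring
  calc _ ≤ 1 * ((B ^ 2 * Real.exp B + (1 / 2 + 2 * T)) * w ^ 2) := by gcongr
    _ = _ := by rw [hw]; field_simp

lemma intervalIntegrable_rpow_mul {α : ℝ} (hα : 0 < α) {f : ℝ → ℝ} (hf : Continuous f) (a b : ℝ) :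
    IntervalIntegrable (fun s => s ^ (α - 1) * f s) volume a b :=
  (intervalIntegral.intervalIntegrable_rpow' (by linarith)).mul_continuousOn hf.continuousOn

lemma integral_rpow_sub_one {α : ℝ} (hα : 0 < α) (z : ℝ) :
    ∫ s in (0:ℝ)..z, s ^ (α - 1) = z ^ α / α := by
  rw [integral_rpow (Or.inl (by linarith))]
  simp [Real.zero_rpow hα.ne']

lemma abs_integral_rpow_mul_le {α z K : ℝ} (hα : 0 < α) (hz : 0 ≤ z) {f : ℝ → ℝ}
    (hK : ∀ s, 0 ≤ s → s ≤ z → |f s| ≤ K) :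
    |∫ s in (0:ℝ)..z, s ^ (α - 1) * f s| ≤ K * (z ^ α / α) := by
  have h := intervalIntegral.norm_integral_le_of_norm_le (f := fun s => s ^ (α - 1) * f s)
    (g := fun s => K * s ^ (α - 1)) (μ := volume) hz
    (Filter.Eventually.of_forall fun s hs => ?_)
    ((intervalIntegral.intervalIntegrable_rpow' (by linarith)).const_mul K)
  · rwa [intervalIntegral.integral_const_mul, integral_rpow_sub_one hα] at h
  · have : 0 ≤ s ^ (α - 1) := Real.rpow_nonneg hs.1.le _
    rw [Real.norm_eq_abs, abs_mul, abs_of_nonneg this, mul_comm K]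
    gcongr
    exact hK s hs.1.le hs.2

lemma integral_rpow_mul_exp_neg_mul {α : ℝ} (hα : 0 < α) {z : ℝ} (hz : 0 ≤ z) :
    ∫ s in (0:ℝ)..z, s ^ (α - 1) * (Real.exp (-s) * (s - s ^ 2 / 2 + α * (α - 1) / 2))
      = z ^ α * Real.exp (-z) * ((α - 1 + z) / 2) := by
  have h := intervalIntegral.integral_eq_sub_of_hasDerivAt_of_le
    (f := fun z => z ^ α * Real.exp (-z) * ((α - 1 + z) / 2))
    (f' := fun s => s ^ (α - 1) * (Real.exp (-s) * (s - s ^ 2 / 2 + α * (α - 1) / 2))) hz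
    ?_ ?_ (intervalIntegrable_rpow_mul hα (by fun_prop) _ _)
  · rw [h]; simp [Real.zero_rpow hα.ne']
  · have : Continuous (fun z : ℝ => z ^ α) := Real.continuous_rpow_const hα.le
    fun_prop
  · intro x hx
    have h1 := ((Real.hasDerivAt_rpow_const (p := α) (Or.inl hx.1.ne')).mul
      (hasDerivAt_neg x).exp).mul (((hasDerivAt_id x).const_add (α - 1)).div_const 2)
    refine h1.congr_deriv ?_
    have : x ^ α = x ^ (α - 1) * x := by
      rw [Real.rpow_sub_one hx.1.ne']; field_simp [hx.1.ne']
    simp only [Pi.mul_apply, id, this]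
    ring

lemma exists_abs_gammaRatio_mul_integral_sub_le {α T : ℝ} (hα : 0 < α) (hT : 0 ≤ T) :
    ∃ C : ℝ, 0 ≤ C ∧ ∀ (j : ℕ) (z : ℝ), 1 ≤ j → 0 ≤ z → z ≤ T → 2 * z ≤ j →
      |gammaRatio α j * (∫ s in (0:ℝ)..z, s ^ (α - 1) * (1 - s / j) ^ (j - 1))
        - (∫ s in (0:ℝ)..z, s ^ (α - 1) * Real.exp (-s))
        - z ^ α * Real.exp (-z) * ((α - 1 + z) / 2) / j|
        ≤ C * (|α - 1| * z ^ α / (j : ℝ) ^ 2 + z ^ 2 / (j : ℝ) ^ 2) := by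
  obtain ⟨K, hK0, hK⟩ := exists_abs_gammaRatio_sub_le hα
  obtain ⟨C, hC0, hC⟩ := exists_abs_one_sub_div_pow_sub_le hT
  set C₁ := T + T ^ 2 / 2 with hC₁
  have hC₁0 : 0 ≤ C₁ := by positivity
  set C₂ := C * (T ^ α / α) with hC₂
  have hC₂0 : 0 ≤ C₂ := by positivity
  refine ⟨K * (1 / α) + α / 2 * (C₁ * (1 / α)) + (|α * (α - 1) / 2| * C₂ + C₂), by positivity,
    fun j z hj hz hzT hzj => ?_⟩
  have hj1 : (1:ℝ) ≤ j := by exact_mod_cast hj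
  have hj0 : (0:ℝ) < j := by linarith
  set J := ∫ s in (0:ℝ)..z, s ^ (α - 1) * (1 - s / j) ^ (j - 1) with hJ
  set G := ∫ s in (0:ℝ)..z, s ^ (α - 1) * Real.exp (-s) with hG
  set J₁ := ∫ s in (0:ℝ)..z, s ^ (α - 1) * (Real.exp (-s) * (s - s ^ 2 / 2)) with hJ₁
  set c := α * (α - 1) / 2 with hc
  have i1 := intervalIntegrable_rpow_mul hα (f := fun s => (1 - s / j) ^ (j - 1)) (by fun_prop) 0 z
  have i2 := intervalIntegrable_rpow_mul hα (f := fun s => Real.exp (-s)) (by fun_prop) 0 z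
  have i3 := intervalIntegrable_rpow_mul hα (f := fun s => Real.exp (-s) * (s - s ^ 2 / 2))
    (by fun_prop) 0 z
  have hid : z ^ α * Real.exp (-z) * ((α - 1 + z) / 2) = J₁ + c * G := by
    rw [← integral_rpow_mul_exp_neg_mul hα hz, hJ₁, hG, ← intervalIntegral.integral_const_mul,
      ← intervalIntegral.integral_add i3 (i2.const_mul c)]
    congr 1; ext s; ring
  have hJb : |J| ≤ 1 * (z ^ α / α) := by
    refine abs_integral_rpow_mul_le hα hz fun s hs hsz => ?_
    have h1 : s / j ≤ 1 := by rw [div_le_one hj0]; linarith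
    have h2 : 0 ≤ s / j := by positivity
    rw [abs_of_nonneg (pow_nonneg (by linarith) _)]
    exact pow_le_one₀ (by linarith) (by linarith)
  have hJ₁b : |J₁| ≤ C₁ * (z ^ α / α) := by
    refine abs_integral_rpow_mul_le hα hz fun s hs hsz => ?_
    have h1 : Real.exp (-s) ≤ 1 := Real.exp_le_one_iff.2 (by linarith)
    have hsT := hsz.trans hzT
    have h2 : |s - s ^ 2 / 2| ≤ C₁ := by
      rw [hC₁, abs_le]; constructor <;> nlinarith [sq_nonneg s, sq_nonneg T]
    rw [abs_mul, abs_of_pos (Real.exp_pos _)]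
    calc _ ≤ 1 * C₁ := by gcongr
      _ = C₁ := one_mul _
  have hE : |J - G - J₁ / j| ≤ C₂ * (z ^ 2 / (j:ℝ) ^ 2) := by
    have e : J - G - J₁ / j = ∫ s in (0:ℝ)..z, s ^ (α - 1) *
        ((1 - s / j) ^ (j - 1) - Real.exp (-s) * (1 + (s - s ^ 2 / 2) / j)) := by
      rw [hJ, hG, hJ₁, ← intervalIntegral.integral_div, ← intervalIntegral.integral_sub i1 i2,
        ← intervalIntegral.integral_sub (i1.sub i2) (i3.div_const _)]
      congr 1; ext s; ring
    rw [e]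
    calc _ ≤ C * z ^ 2 / (j:ℝ) ^ 2 * (z ^ α / α) := by
          refine abs_integral_rpow_mul_le hα hz fun s hs hsz => ?_
          refine (hC j s hj hs (hsz.trans hzT) (by linarith)).trans ?_
          gcongr
      _ ≤ C * z ^ 2 / (j:ℝ) ^ 2 * (T ^ α / α) := by gcongr
      _ = _ := by rw [hC₂]; ring
  have hρ := hK j hj
  rw [hid]
  have key : gammaRatio α j * J - G - (J₁ + c * G) / j
      = (gammaRatio α j - 1 - c / j) * J + c / j * (J₁ / j) + (c / j * (J - G - J₁ / j)
        + (J - G - J₁ / j)) := by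
    field_simp
    ring
  have hcα : |c| = α / 2 * |α - 1| := by
    rw [hc, abs_div, abs_mul, abs_of_pos hα, abs_two]; ring
  have hz0 : 0 ≤ z ^ α := Real.rpow_nonneg hz _
  rw [key]
  have b1 : |(gammaRatio α j - 1 - c / j) * J| ≤ K * |α - 1| / (j:ℝ) ^ 2 * (1 * (z ^ α / α)) := by
    rw [abs_mul]; gcongr
  have b2 : |c / j * (J₁ / j)| ≤ α / 2 * |α - 1| / j * (C₁ * (z ^ α / α) / j) := by
    rw [abs_mul, abs_div c, abs_div J₁, hcα, abs_of_pos hj0]; gcongr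
  have b3 : |c / j * (J - G - J₁ / j)| ≤ |c| * (C₂ * (z ^ 2 / (j:ℝ) ^ 2)) := by
    rw [abs_mul, abs_div, abs_of_pos hj0]
    gcongr
    exact div_le_self (abs_nonneg _) hj1
  calc _ ≤ K * |α - 1| / (j:ℝ) ^ 2 * (1 * (z ^ α / α))
        + α / 2 * |α - 1| / j * (C₁ * (z ^ α / α) / j)
        + (|c| * (C₂ * (z ^ 2 / (j:ℝ) ^ 2)) + C₂ * (z ^ 2 / (j:ℝ) ^ 2)) :=
        (abs_add_le _ _).trans (add_le_add ((abs_add_le _ _).trans (add_le_add b1 b2))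
          ((abs_add_le _ _).trans (add_le_add b3 hE)))
    _ = (K * (1 / α) + α / 2 * (C₁ * (1 / α))) * (|α - 1| * z ^ α / (j : ℝ) ^ 2)
        + (|c| * C₂ + C₂) * (z ^ 2 / (j : ℝ) ^ 2) := by field_simp
    _ ≤ _ := by
        have q1 : 0 ≤ |α - 1| * z ^ α / (j : ℝ) ^ 2 := by positivity
        have q2 : 0 ≤ z ^ 2 / (j : ℝ) ^ 2 := by positivity
        have q3 : 0 ≤ K * (1 / α) + α / 2 * (C₁ * (1 / α)) := by positivity
        have q4 : 0 ≤ |c| * C₂ + C₂ := by positivity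
        nlinarith [mul_nonneg q3 q2, mul_nonneg q4 q1]

lemma intervalIntegrable_pow_mul_one_sub_rpow {α : ℝ} (hα : 0 < α) (j : ℕ) (a b : ℝ) :
    IntervalIntegrable (fun y : ℝ => y ^ (j - 1) * (1 - y) ^ (α - 1)) volume a b := by
  have h := (intervalIntegral.intervalIntegrable_rpow' (r := α - 1) (by linarith)
    (a := 1 - a) (b := 1 - b)).comp_sub_left 1
  simp only [sub_sub_cancel] at h
  exact h.continuousOn_mul (by fun_prop)

lemma incBeta_one {α : ℝ} (hα : 0 < α) {j : ℕ} (hj : 1 ≤ j) :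
    incBeta 1 j α = Real.Gamma j * Real.Gamma α / Real.Gamma (j + α) := by
  have hj0 : (0:ℝ) < j := by exact_mod_cast hj
  have h := Complex.betaIntegral_eq_Gamma_mul_div (j:ℂ) (α:ℂ) (by simpa using (show 0 < j by omega)) (by simpa)
  have e : Complex.betaIntegral (j:ℂ) (α:ℂ) = ((incBeta 1 j α : ℝ) : ℂ) := by
    unfold Complex.betaIntegral incBeta
    rw [← intervalIntegral.integral_ofReal]
    refine intervalIntegral.integral_congr fun y hy => ?_
    rw [Set.uIcc_of_le zero_le_one] at hy
    push_cast
    rw [Complex.ofReal_cpow (by linarith [hy.2])]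
    push_cast
    congr 1
    rw [← Complex.cpow_natCast, Nat.cast_sub hj]
    simp
  rw [e] at h
  have h2 : Complex.Gamma j * Complex.Gamma α / Complex.Gamma (j + α)
      = ((Real.Gamma j * Real.Gamma α / Real.Gamma (j + α) : ℝ) : ℂ) := by
    push_cast [← Complex.Gamma_ofReal]
    rfl
  rw [h2] at h
  exact_mod_cast h

lemma incBeta_one_pos {α : ℝ} (hα : 0 < α) {j : ℕ} (hj : 1 ≤ j) : 0 < incBeta 1 j α := by
  have hj0 : (0:ℝ) < j := by exact_mod_cast hj
  rw [incBeta_one hα hj]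
  have := Real.Gamma_pos_of_pos hj0
  have := Real.Gamma_pos_of_pos hα
  have := Real.Gamma_pos_of_pos (add_pos hj0 hα)
  positivity

lemma incBeta_mono {α : ℝ} (hα : 0 < α) (j : ℕ) {v v' : ℝ} (hv : 0 ≤ v) (hvv' : v ≤ v')
    (hv' : v' ≤ 1) : incBeta v j α ≤ incBeta v' j α := by
  have h := intervalIntegral.integral_add_adjacent_intervals
    (intervalIntegrable_pow_mul_one_sub_rpow hα j 0 v)
    (intervalIntegrable_pow_mul_one_sub_rpow hα j v v')
  have h2 : 0 ≤ ∫ y in v..v', y ^ (j - 1) * (1 - y) ^ (α - 1) :=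
    intervalIntegral.integral_nonneg hvv' fun y hy =>
      mul_nonneg (pow_nonneg (hv.trans hy.1) _) (Real.rpow_nonneg (by linarith [hy.2]) _)
  unfold incBeta
  linarith

lemma normIncBeta_mono {α : ℝ} (hα : 0 < α) {j : ℕ} (hj : 1 ≤ j) {v v' : ℝ} (hv : 0 ≤ v)
    (hvv' : v ≤ v') (hv' : v' ≤ 1) : normIncBeta v j α ≤ normIncBeta v' j α :=
  div_le_div_of_nonneg_right (incBeta_mono hα j hv hvv' hv') (incBeta_one_pos hα hj).le

lemma normIncBeta_nonneg {α : ℝ} (hα : 0 < α) {j : ℕ} (hj : 1 ≤ j) {v : ℝ} (hv : 0 ≤ v)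
    (hv' : v ≤ 1) : 0 ≤ normIncBeta v j α := by
  have := normIncBeta_mono hα hj le_rfl hv hv'
  simpa [normIncBeta, incBeta] using this

lemma normIncBeta_one {α : ℝ} (hα : 0 < α) {j : ℕ} (hj : 1 ≤ j) : normIncBeta 1 j α = 1 :=
  div_self (incBeta_one_pos hα hj).ne'

lemma normIncBeta_le_one {α : ℝ} (hα : 0 < α) {j : ℕ} (hj : 1 ≤ j) {v : ℝ} (hv : 0 ≤ v)
    (hv' : v ≤ 1) : normIncBeta v j α ≤ 1 :=
  (normIncBeta_mono hα hj hv hv' le_rfl).trans (normIncBeta_one hα hj).le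

lemma one_sub_normIncBeta {α : ℝ} (hα : 0 < α) {j : ℕ} (hj : 1 ≤ j) {z : ℝ} (hz : 0 ≤ z) :
    1 - normIncBeta (1 - z / j) j α
      = gammaRatio α j / Real.Gamma α *
        ∫ s in (0:ℝ)..z, s ^ (α - 1) * (1 - s / j) ^ (j - 1) := by
  have hj0 : (0:ℝ) < j := by exact_mod_cast hj
  have hB := incBeta_one_pos hα hj
  have h1 : incBeta 1 j α - incBeta (1 - z / j) j α
      = ∫ y in (1 - z / j)..1, y ^ (j - 1) * (1 - y) ^ (α - 1) :=
    intervalIntegral.integral_interval_sub_left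
      (intervalIntegrable_pow_mul_one_sub_rpow hα j _ _)
      (intervalIntegrable_pow_mul_one_sub_rpow hα j _ _)
  have h2 : ∫ y in (1 - z / j)..1, y ^ (j - 1) * (1 - y) ^ (α - 1)
      = ∫ y in (0:ℝ)..(z / j), (1 - y) ^ (j - 1) * y ^ (α - 1) := by
    have := intervalIntegral.integral_comp_sub_left
      (fun y : ℝ => (1 - y) ^ (j - 1) * y ^ (α - 1)) (a := 1 - z / j) (b := 1) 1
    simpa using this
  have h3 : ∫ s in (0:ℝ)..z, s ^ (α - 1) * (1 - s / j) ^ (j - 1)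
      = (j:ℝ) ^ α * ∫ y in (0:ℝ)..(z / j), (1 - y) ^ (j - 1) * y ^ (α - 1) := by
    have := intervalIntegral.integral_comp_div
      (fun y : ℝ => (1 - y) ^ (j - 1) * y ^ (α - 1)) (a := 0) (b := z) hj0.ne'
    rw [zero_div, smul_eq_mul] at this
    rw [show (j:ℝ) ^ α = (j:ℝ) ^ (α - 1) * j by rw [Real.rpow_sub_one hj0.ne']; field_simp,
      mul_assoc, ← this, ← intervalIntegral.integral_const_mul]
    refine intervalIntegral.integral_congr fun s hs => ?_
    rw [Set.uIcc_of_le hz] at hs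
    rw [Real.div_rpow hs.1 hj0.le]
    have : 0 < (j:ℝ) ^ (α - 1) := by positivity
    field_simp
  have h4 : 1 - normIncBeta (1 - z / j) j α
      = (incBeta 1 j α - incBeta (1 - z / j) j α) / incBeta 1 j α := by
    unfold normIncBeta; field_simp
  rw [h4, h1, h2, h3, incBeta_one hα hj]
  unfold gammaRatio
  have := Real.Gamma_pos_of_pos hj0
  have := Real.Gamma_pos_of_pos hα
  have := Real.Gamma_pos_of_pos (add_pos hj0 hα)
  have : 0 < (j:ℝ) ^ α := by positivity
  field_simp

lemma integrableOn_rpow_mul_exp_neg {α : ℝ} (hα : 0 < α) :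
    IntegrableOn (fun s : ℝ => s ^ (α - 1) * Real.exp (-s)) (Set.Ioi 0) := by
  simpa only [mul_comm] using Real.GammaIntegral_convergent hα

lemma incGamma_zero {α : ℝ} (hα : 0 < α) : incGamma α 0 = Real.Gamma α := by
  rw [Real.Gamma_eq_integral hα, incGamma]
  simp only [mul_comm]

lemma incGamma_eq_Gamma_sub {α : ℝ} (hα : 0 < α) {z : ℝ} (hz : 0 ≤ z) :
    incGamma α z = Real.Gamma α - ∫ s in (0:ℝ)..z, s ^ (α - 1) * Real.exp (-s) := by
  have hi := integrableOn_rpow_mul_exp_neg hα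
  have h := intervalIntegral.integral_Ioi_sub_Ioi hi hz
  rw [← incGamma_zero hα, ← h]
  unfold incGamma
  ring

lemma one_sub_Qfun {α : ℝ} (hα : 0 < α) {z : ℝ} (hz : 0 ≤ z) :
    1 - Qfun α z = (∫ s in (0:ℝ)..z, s ^ (α - 1) * Real.exp (-s)) / Real.Gamma α := by
  have := Real.Gamma_pos_of_pos hα
  unfold Qfun
  rw [incGamma_eq_Gamma_sub hα hz]
  field_simp
  ring

lemma one_sub_Qfun_mul {α : ℝ} (hα : 0 < α) {t x : ℝ} (ht : 0 ≤ t) (hx : 0 ≤ x) :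
    1 - Qfun α (t * x)
      = t ^ α / Real.Gamma α * ∫ y in (0:ℝ)..x, y ^ (α - 1) * Real.exp (-(t * y)) := by
  rw [one_sub_Qfun hα (mul_nonneg ht hx)]
  rcases ht.eq_or_lt with rfl | ht
  · simp [Real.zero_rpow hα.ne']
  have := intervalIntegral.integral_comp_mul_left
      (fun s : ℝ => s ^ (α - 1) * Real.exp (-s)) (a := 0) (b := x) ht.ne'
  rw [mul_zero, smul_eq_mul] at this
  have h2 : ∫ y in (0:ℝ)..x, (t * y) ^ (α - 1) * Real.exp (-(t * y))
      = t ^ (α - 1) * ∫ y in (0:ℝ)..x, y ^ (α - 1) * Real.exp (-(t * y)) := by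
    rw [← intervalIntegral.integral_const_mul]
    refine intervalIntegral.integral_congr fun s hs => ?_
    rw [Set.uIcc_of_le hx] at hs
    rw [Real.mul_rpow ht.le hs.1, mul_assoc]
  rw [h2] at this
  have h3 : t ^ α = t ^ (α - 1) * t := by rw [Real.rpow_sub_one ht.ne']; field_simp
  have hG := Real.Gamma_pos_of_pos hα
  rw [h3]
  field_simp at this ⊢
  linarith

lemma Qfun_antitone {α : ℝ} (hα : 0 < α) {z z' : ℝ} (hz : 0 ≤ z) (hzz' : z ≤ z') :
    Qfun α z' ≤ Qfun α z := by
  refine div_le_div_of_nonneg_right ?_ (Real.Gamma_pos_of_pos hα).le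
  rw [incGamma, incGamma]
  have hi := (integrableOn_rpow_mul_exp_neg hα).mono_set (Set.Ioi_subset_Ioi hz)
  refine setIntegral_mono_set hi ?_ (Set.Ioi_subset_Ioi hzz').eventuallyLE
  filter_upwards [ae_restrict_mem measurableSet_Ioi] with s hs
  have : 0 < s := hz.trans_lt hs
  simp only [Pi.zero_apply]
  positivity

lemma Qfun_nonneg {α : ℝ} (hα : 0 < α) {z : ℝ} (hz : 0 ≤ z) : 0 ≤ Qfun α z := by
  refine div_nonneg (setIntegral_nonneg measurableSet_Ioi fun s hs => ?_)
    (Real.Gamma_pos_of_pos hα).le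
  have : 0 < s := hz.trans_lt hs
  positivity

lemma Qfun_le_one {α : ℝ} (hα : 0 < α) {z : ℝ} (hz : 0 ≤ z) : Qfun α z ≤ 1 := by
  refine (Qfun_antitone hα le_rfl hz).trans (le_of_eq ?_)
  rw [Qfun, incGamma_zero hα, div_self (Real.Gamma_pos_of_pos hα).ne']

lemma exists_abs_normIncBeta_sub_le {α t : ℝ} (hα : 0 < α) (ht : 0 ≤ t) :
    ∃ C : ℝ, 0 ≤ C ∧ ∀ n j : ℕ, 2 * t ≤ n → 1 ≤ j → j ≤ n →
      |normIncBeta (1 - t / n) j α - Qfun α (t * (j / n))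
        - ((j:ℝ) / n) ^ (α - 1) * (Real.exp (-(t * (j / n))) * t ^ α / Real.Gamma α
          * ((1 - α - t * (j / n)) / 2)) / n|
        ≤ C * (envelope α ((j:ℝ) / n) / (n : ℝ) ^ 2) := by
  obtain ⟨C, hC0, hC⟩ := exists_abs_gammaRatio_mul_integral_sub_le hα ht
  have hG := Real.Gamma_pos_of_pos hα
  refine ⟨C / Real.Gamma α * (t ^ α + t ^ 2), by positivity, fun n j hn hj hjn => ?_⟩
  have hj0 : (0:ℝ) < j := by exact_mod_cast hj
  have hn0 : (0:ℝ) < n := by exact_mod_cast (show 0 < n by omega)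
  have hjn' : (j:ℝ) ≤ n := by exact_mod_cast hjn
  set x := (j:ℝ) / n with hx
  have hx0 : 0 < x := by positivity
  have hx1 : x ≤ 1 := by rw [hx, div_le_one hn0]; exact hjn'
  have hjx : (j:ℝ) = n * x := by rw [hx]; field_simp
  set z := t * x with hz
  have hz0 : 0 ≤ z := by positivity
  have hzj : z / j = t / n := by rw [hz, hjx]; field_simp
  have h := hC j z hj hz0 (mul_le_of_le_one_right ht hx1) (by rw [hz, hjx]; nlinarith)
  have e1 := one_sub_normIncBeta hα hj hz0
  have e2 := one_sub_Qfun hα hz0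
  rw [hzj] at e1
  have hzα : z ^ α = t ^ α * (x ^ (α - 1) * x) := by
    rw [hz, Real.mul_rpow ht hx0.le, Real.rpow_sub_one hx0.ne']; field_simp
  have hzα2 : z ^ α = t ^ α * (x ^ (α - 2) * x ^ 2) := by
    rw [hz, Real.mul_rpow ht hx0.le, Real.rpow_sub hx0, Real.rpow_two]; field_simp
  set X := gammaRatio α j * ∫ s in (0:ℝ)..z, s ^ (α - 1) * (1 - s / j) ^ (j - 1) with hX
  set Y := ∫ s in (0:ℝ)..z, s ^ (α - 1) * Real.exp (-s) with hY
  have e1' : normIncBeta (1 - t / n) j α = 1 - X / Real.Gamma α := by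
    rw [div_mul_eq_mul_div] at e1
    linarith
  have key : normIncBeta (1 - t / n) j α - Qfun α z
      - x ^ (α - 1) * (Real.exp (-z) * t ^ α / Real.Gamma α * ((1 - α - z) / 2)) / n
      = - (X - Y - z ^ α * Real.exp (-z) * ((α - 1 + z) / 2) / j) / Real.Gamma α := by
    have : z ^ α * Real.exp (-z) * ((α - 1 + z) / 2) / j
      = t ^ α * x ^ (α - 1) * Real.exp (-z) * ((α - 1 + z) / 2) / n := by
      rw [hzα, hjx]; field_simp
    rw [this, e1', show Qfun α z = 1 - Y / Real.Gamma α by linarith]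
    field_simp
    ring
  rw [key, abs_div, abs_neg, abs_of_pos hG]
  calc _ ≤ C * (|α - 1| * z ^ α / (j : ℝ) ^ 2 + z ^ 2 / (j : ℝ) ^ 2) / Real.Gamma α := by gcongr
    _ = C / Real.Gamma α * ((t ^ α * (|α - 1| * x ^ (α - 2)) + t ^ 2 * 1) / (n:ℝ) ^ 2) := by
        rw [hzα2, hz, hjx]; field_simp
    _ ≤ C / Real.Gamma α * ((t ^ α * envelope α x + t ^ 2 * envelope α x) / (n:ℝ) ^ 2) := by
        have := one_le_envelope α hx0
        gcongr
        unfold envelope; linarith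
    _ = _ := by ring

lemma abs_integral_sub_mul_left_le {f f' : ℝ → ℝ} {a b K : ℝ} (hab : a ≤ b)
    (hf : ∀ x ∈ Set.Icc a b, HasDerivAt f (f' x) x) (hK : ∀ x ∈ Set.Icc a b, |f' x| ≤ K) :
    |(∫ x in a..b, f x) - (b - a) * f a| ≤ K * (b - a) ^ 2 := by
  have hi : IntervalIntegrable f volume a b :=
    ContinuousOn.intervalIntegrable_of_Icc hab
      fun x hx => (hf x hx).continuousAt.continuousWithinAt
  have hK0 : 0 ≤ K := (abs_nonneg _).trans (hK a ⟨le_rfl, hab⟩)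
  have h1 : (∫ x in a..b, f x) - (b - a) * f a = ∫ x in a..b, (f x - f a) := by
    rw [intervalIntegral.integral_sub hi (by simp)]
    simp
  rw [h1]
  have h2 := intervalIntegral.norm_integral_le_of_norm_le_const (a := a) (b := b)
    (f := fun x => f x - f a) (C := K * (b - a)) fun x hx => ?_
  · rw [abs_of_nonneg (sub_nonneg.2 hab)] at h2
    refine h2.trans (le_of_eq ?_)
    ring
  · rw [Set.uIoc_of_le hab] at hx
    refine ((convex_Icc a b).norm_image_sub_le_of_norm_hasDerivWithin_le
      (fun x hx => (hf x hx).hasDerivWithinAt) hK ⟨le_rfl, hab⟩ ⟨hx.1.le, hx.2⟩).trans ?_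
    rw [Real.norm_of_nonneg (by linarith [hx.1])]
    have := hx.2
    gcongr

lemma abs_integral_sub_trapezoid_le {f f' f'' : ℝ → ℝ} {a b K : ℝ} (hab : a ≤ b)
    (hf : ∀ x ∈ Set.Icc a b, HasDerivAt f (f' x) x)
    (hf' : ∀ x ∈ Set.Icc a b, HasDerivAt f' (f'' x) x) (hK : ∀ x ∈ Set.Icc a b, |f'' x| ≤ K) :
    |(∫ x in a..b, f x) - (b - a) * ((f a + f b) / 2)| ≤ 2 * K * (b - a) ^ 3 := by
  have hi : IntervalIntegrable f volume a b :=
    ContinuousOn.intervalIntegrable_of_Icc hab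
      fun x hx => (hf x hx).continuousAt.continuousWithinAt
  have hK0 : 0 ≤ K := (abs_nonneg _).trans (hK a ⟨le_rfl, hab⟩)
  have hba : 0 ≤ b - a := sub_nonneg.2 hab
  have h1 : ∀ x ∈ Set.Icc a b, |f' x - f' a| ≤ K * (b - a) := fun x hx => by
    refine ((convex_Icc a b).norm_image_sub_le_of_norm_hasDerivWithin_le
      (fun x hx => (hf' x hx).hasDerivWithinAt) hK ⟨le_rfl, hab⟩ hx).trans ?_
    rw [Real.norm_of_nonneg (by linarith [hx.1])]
    have := hx.2
    gcongr
  have h2 : ∀ x ∈ Set.Icc a b, |f x - f a - (x - a) * f' a| ≤ K * (b - a) ^ 2 := fun x hx => by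
    have := (convex_Icc a b).norm_image_sub_le_of_norm_hasDerivWithin_le
      (f := fun x => f x - x * f' a) (f' := fun x => f' x - f' a)
      (fun x hx => by
        have := ((hf x hx).sub ((hasDerivAt_id x).mul_const (f' a))).hasDerivWithinAt
          (s := Set.Icc a b)
        rw [one_mul] at this
        exact this)
      h1 ⟨le_rfl, hab⟩ hx
    rw [Real.norm_of_nonneg (show 0 ≤ x - a by linarith [hx.1])] at this
    calc _ = ‖f x - x * f' a - (f a - a * f' a)‖ := by rw [Real.norm_eq_abs]; congr 1; ring
      _ ≤ _ := this
      _ ≤ K * (b - a) * (b - a) := by have := hx.2; gcongr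
      _ = _ := by ring
  have h3 := intervalIntegral.norm_integral_le_of_norm_le_const (a := a) (b := b)
    (f := fun x => f x - f a - (x - a) * f' a) (C := K * (b - a) ^ 2) fun x hx => by
      rw [Set.uIoc_of_le hab] at hx
      exact h2 x ⟨hx.1.le, hx.2⟩
  have h4 : ∫ x in a..b, (f x - f a - (x - a) * f' a)
      = (∫ x in a..b, f x) - (b - a) * f a - (b - a) ^ 2 / 2 * f' a := by
    rw [intervalIntegral.integral_sub (hi.sub (by simp))
        (Continuous.intervalIntegrable (by fun_prop) _ _),
      intervalIntegral.integral_sub hi (by simp), intervalIntegral.integral_mul_const,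
      intervalIntegral.integral_sub (by simp) (by simp)]
    simp only [intervalIntegral.integral_const, integral_id, smul_eq_mul]
    ring
  rw [h4, Real.norm_eq_abs, abs_of_nonneg hba] at h3
  have h5 := mul_le_mul_of_nonneg_left (h2 b ⟨hab, le_rfl⟩) hba
  have h6 : |(b - a) / 2 * (f b - f a - (b - a) * f' a)| ≤ K * (b - a) ^ 3 := by
    rw [abs_mul, abs_of_nonneg (by linarith)]
    nlinarith [abs_nonneg (f b - f a - (b - a) * f' a)]
  calc _ = |((∫ x in a..b, f x) - (b - a) * f a - (b - a) ^ 2 / 2 * f' a)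
        - (b - a) / 2 * (f b - f a - (b - a) * f' a)| := by congr 1; ring
    _ ≤ K * (b - a) ^ 2 * (b - a) + K * (b - a) ^ 3 := (abs_sub _ _).trans (add_le_add h3 h6)
    _ = _ := by ring

lemma sum_integral_Ico_div {f : ℝ → ℝ} {n N : ℕ} (hn : 0 < n) (hN : N ≤ n)
    (hf : ContinuousOn f (Set.Icc ((N:ℝ) / n) 1)) :
    ∑ j ∈ Finset.Ico N n, ∫ x in ((j:ℝ) / n)..((j + 1 : ℕ) / n : ℝ), f x
      = ∫ x in ((N:ℝ) / n)..1, f x := by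
  have hn' : (0:ℝ) < n := by exact_mod_cast hn
  have h := intervalIntegral.sum_integral_adjacent_intervals_Ico (f := f) (μ := volume)
    (a := fun j : ℕ => (j:ℝ) / n) hN fun k hk => ?_
  · rw [h, div_self hn'.ne']
  · refine ContinuousOn.intervalIntegrable_of_Icc (by gcongr; simp) (hf.mono ?_)
    refine Set.Icc_subset_Icc (by have := hk.1; gcongr) ?_
    rw [div_le_one hn']
    exact_mod_cast hk.2

lemma envelope_le_of_mem_grid {α : ℝ} {n j : ℕ} (hj : 1 ≤ j) (hn : 0 < n) {x : ℝ}
    (hx : x ∈ Set.Icc ((j:ℝ) / n) ((j + 1 : ℕ) / n : ℝ)) :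
    envelope α x ≤ 2 ^ |α - 2| * envelope α ((j:ℝ) / n) := by
  have hn' : (0:ℝ) < n := by exact_mod_cast hn
  have hj' : (1:ℝ) ≤ j := by exact_mod_cast hj
  refine envelope_le_two_rpow_abs_mul (by positivity) hx.1 (hx.2.trans ?_)
  rw [← mul_div_assoc]
  push_cast
  gcongr
  linarith

lemma exists_abs_sum_sub_integral_le {α K : ℝ} {f f' : ℝ → ℝ}
    (hf : ∀ x, 0 < x → x ≤ 1 → HasDerivAt f (f' x) x)
    (hK : ∀ x, 0 < x → x ≤ 1 → |f' x| ≤ K * envelope α x) :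
    ∃ C : ℝ, 0 ≤ C ∧ ∀ n N : ℕ, 1 ≤ N → N ≤ n →
      |∑ j ∈ Finset.Icc N n, f ((j:ℝ) / n) / n - ∫ x in ((N:ℝ) / n)..1, f x|
        ≤ C * ((1 + ((N:ℝ) / n) ^ (α - 1)) / n) := by
  obtain ⟨C, hC0, hC⟩ := exists_sum_envelope_le α
  have hK0 : 0 ≤ K := by
    have := (abs_nonneg _).trans (hK 1 one_pos le_rfl)
    exact nonneg_of_mul_nonneg_left this (envelope_pos α one_pos)
  refine ⟨K * 2 ^ |α - 2| * C + |f 1|, by positivity, fun n N hN hNn => ?_⟩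
  have hn : 0 < n := by omega
  have hn' : (0:ℝ) < n := by exact_mod_cast hn
  have hN' : (0:ℝ) < N := by exact_mod_cast hN
  have hpos : ∀ x, (N:ℝ) / n ≤ x → 0 < x := fun x hx => lt_of_lt_of_le (by positivity) hx
  have hcont : ContinuousOn f (Set.Icc ((N:ℝ) / n) 1) := fun x hx =>
    (hf x (hpos x hx.1) hx.2).continuousAt.continuousWithinAt
  have hterm : ∀ j ∈ Finset.Ico N n,
      |f ((j:ℝ) / n) / n - ∫ x in ((j:ℝ) / n)..((j + 1 : ℕ) / n : ℝ), f x|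
        ≤ K * 2 ^ |α - 2| * envelope α ((j:ℝ) / n) / n ^ 2 := fun j hj => by
    rw [Finset.mem_Ico] at hj
    have hj0 : (0:ℝ) < j := by exact_mod_cast (show 0 < j by omega)
    have hx0 : ∀ x ∈ Set.Icc ((j:ℝ) / n) ((j + 1 : ℕ) / n : ℝ), 0 < x ∧ x ≤ 1 := fun x hx =>
      ⟨lt_of_lt_of_le (by positivity) hx.1, hx.2.trans (by
        rw [div_le_one hn']; exact_mod_cast hj.2)⟩
    have h := abs_integral_sub_mul_left_le (a := (j:ℝ) / n) (b := ((j + 1 : ℕ) / n : ℝ))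
      (K := K * (2 ^ |α - 2| * envelope α ((j:ℝ) / n))) (by gcongr; simp)
      (fun x hx => hf x (hx0 x hx).1 (hx0 x hx).2)
      (fun x hx => (hK x (hx0 x hx).1 (hx0 x hx).2).trans
        (mul_le_mul_of_nonneg_left (envelope_le_of_mem_grid (by omega) hn hx) hK0))
    have e : ((j + 1 : ℕ) / n : ℝ) - j / n = 1 / n := by push_cast; ring
    rw [e, abs_sub_comm] at h
    calc _ = _ := by rw [one_div_mul_eq_div]
      _ ≤ _ := h
      _ = _ := by field_simp
  rw [← sum_integral_Ico_div hn hNn hcont, ← Finset.sum_Ico_add_eq_sum_Icc hNn]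
  have hsum := Finset.sum_le_sum hterm
  have habs := Finset.abs_sum_le_sum_abs
    (fun j : ℕ => f ((j:ℝ) / n) / n - ∫ x in ((j:ℝ) / n)..((j + 1 : ℕ) / n : ℝ), f x)
    (Finset.Ico N n)
  rw [Finset.sum_sub_distrib] at habs
  have hE : ∑ j ∈ Finset.Ico N n, K * 2 ^ |α - 2| * envelope α ((j:ℝ) / n) / n ^ 2
      ≤ K * 2 ^ |α - 2| * C * ((1 + ((N:ℝ) / n) ^ (α - 1)) / n) := by
    rw [← Finset.sum_div, ← Finset.mul_sum]
    have h1 : ∑ j ∈ Finset.Ico N n, envelope α ((j:ℝ) / n)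
        ≤ C * (n * (1 + ((N:ℝ) / n) ^ (α - 1))) := by
      refine le_trans ?_ (hC n N hN hNn)
      rw [← Finset.sum_Ico_add_eq_sum_Icc hNn]
      have := envelope_pos α (show (0:ℝ) < (n:ℝ) / n by positivity)
      linarith
    calc _ ≤ K * 2 ^ |α - 2| * (C * (n * (1 + ((N:ℝ) / n) ^ (α - 1)))) / n ^ 2 := by gcongr
      _ = _ := by field_simp
  have hlast : |f ((n:ℝ) / n) / n| ≤ |f 1| * ((1 + ((N:ℝ) / n) ^ (α - 1)) / n) := by
    rw [div_self hn'.ne', abs_div, abs_of_pos hn', ← mul_div_assoc]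
    gcongr
    have : 0 < ((N:ℝ) / n) ^ (α - 1) := by positivity
    nlinarith [abs_nonneg (f 1)]
  rw [add_sub_right_comm]
  refine (abs_add_le _ _).trans ?_
  rw [add_mul]
  exact add_le_add (habs.trans (hsum.trans hE)) hlast

lemma exists_abs_sum_sub_trapezoid_le {α K : ℝ} {f f' f'' : ℝ → ℝ}
    (hf : ∀ x, 0 < x → x ≤ 1 → HasDerivAt f (f' x) x)
    (hf' : ∀ x, 0 < x → x ≤ 1 → HasDerivAt f' (f'' x) x)
    (hK : ∀ x, 0 < x → x ≤ 1 → |f'' x| ≤ K * envelope α x) :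
    ∃ C : ℝ, 0 ≤ C ∧ ∀ n N : ℕ, 1 ≤ N → N ≤ n →
      |∑ j ∈ Finset.Icc N n, f ((j:ℝ) / n) - n * (∫ x in ((N:ℝ) / n)..1, f x)
          - (f ((N:ℝ) / n) + f 1) / 2|
        ≤ C * ((1 + ((N:ℝ) / n) ^ (α - 1)) / n) := by
  obtain ⟨C, hC0, hC⟩ := exists_sum_envelope_le α
  have hK0 : 0 ≤ K := by
    have := (abs_nonneg _).trans (hK 1 one_pos le_rfl)
    exact nonneg_of_mul_nonneg_left this (envelope_pos α one_pos)
  refine ⟨2 * (K * 2 ^ |α - 2|) * C, by positivity, fun n N hN hNn => ?_⟩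
  have hn : 0 < n := by omega
  have hn' : (0:ℝ) < n := by exact_mod_cast hn
  have hN' : (0:ℝ) < N := by exact_mod_cast hN
  have hpos : ∀ x, (N:ℝ) / n ≤ x → 0 < x := fun x hx => lt_of_lt_of_le (by positivity) hx
  have hcont : ContinuousOn f (Set.Icc ((N:ℝ) / n) 1) := fun x hx =>
    (hf x (hpos x hx.1) hx.2).continuousAt.continuousWithinAt
  have hterm : ∀ j ∈ Finset.Ico N n,
      |(f ((j:ℝ) / n) + f ((j + 1 : ℕ) / n : ℝ)) / 2
          - n * ∫ x in ((j:ℝ) / n)..((j + 1 : ℕ) / n : ℝ), f x|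
        ≤ 2 * (K * 2 ^ |α - 2|) * envelope α ((j:ℝ) / n) / n ^ 2 := fun j hj => by
    rw [Finset.mem_Ico] at hj
    have hj0 : (0:ℝ) < j := by exact_mod_cast (show 0 < j by omega)
    have hx0 : ∀ x ∈ Set.Icc ((j:ℝ) / n) ((j + 1 : ℕ) / n : ℝ), 0 < x ∧ x ≤ 1 := fun x hx =>
      ⟨lt_of_lt_of_le (by positivity) hx.1, hx.2.trans (by
        rw [div_le_one hn']; exact_mod_cast hj.2)⟩
    have h := abs_integral_sub_trapezoid_le (a := (j:ℝ) / n) (b := ((j + 1 : ℕ) / n : ℝ))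
      (K := K * (2 ^ |α - 2| * envelope α ((j:ℝ) / n))) (by gcongr; simp)
      (fun x hx => hf x (hx0 x hx).1 (hx0 x hx).2)
      (fun x hx => hf' x (hx0 x hx).1 (hx0 x hx).2)
      (fun x hx => (hK x (hx0 x hx).1 (hx0 x hx).2).trans
        (mul_le_mul_of_nonneg_left (envelope_le_of_mem_grid (by omega) hn hx) hK0))
    have e : ((j + 1 : ℕ) / n : ℝ) - j / n = 1 / n := by push_cast; ring
    rw [e, abs_sub_comm] at h
    calc _ = n * |1 / n * ((f ((j:ℝ) / n) + f ((j + 1 : ℕ) / n : ℝ)) / 2)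
          - ∫ x in ((j:ℝ) / n)..((j + 1 : ℕ) / n : ℝ), f x| := by
          rw [← abs_of_pos hn', ← abs_mul, abs_of_pos hn', mul_sub, ← mul_assoc,
            mul_one_div_cancel hn'.ne', one_mul]
      _ ≤ _ := mul_le_mul_of_nonneg_left h hn'.le
      _ = _ := by field_simp
  have hS : ∑ j ∈ Finset.Icc N n, f ((j:ℝ) / n) - (f ((N:ℝ) / n) + f 1) / 2
      = ∑ j ∈ Finset.Ico N n, (f ((j:ℝ) / n) + f ((j + 1 : ℕ) / n : ℝ)) / 2 := by
    have h1 := Finset.sum_Ico_add_eq_sum_Icc (f := fun j : ℕ => f ((j:ℝ) / n)) hNn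
    have h2 := Finset.sum_Ico_sub (fun j : ℕ => f ((j:ℝ) / n)) hNn
    rw [Finset.sum_sub_distrib] at h2
    rw [← Finset.sum_div, Finset.sum_add_distrib, ← h1]
    rw [div_self hn'.ne'] at *
    linarith
  rw [sub_right_comm, hS, ← sum_integral_Ico_div hn hNn hcont, Finset.mul_sum,
    ← Finset.sum_sub_distrib]
  refine (Finset.abs_sum_le_sum_abs _ _).trans ((Finset.sum_le_sum hterm).trans ?_)
  rw [← Finset.sum_div, ← Finset.mul_sum]
  have h1 : ∑ j ∈ Finset.Ico N n, envelope α ((j:ℝ) / n)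
      ≤ C * (n * (1 + ((N:ℝ) / n) ^ (α - 1))) := by
    refine le_trans ?_ (hC n N hN hNn)
    rw [← Finset.sum_Ico_add_eq_sum_Icc hNn]
    have := envelope_pos α (show (0:ℝ) < (n:ℝ) / n by positivity)
    linarith
  calc _ ≤ 2 * (K * 2 ^ |α - 2|) * (C * (n * (1 + ((N:ℝ) / n) ^ (α - 1)))) / n ^ 2 := by gcongr
    _ = _ := by field_simp

lemma omegaCoef_zero {m : ℕ} (u : Fin (m + 1) → ℝ) :
    omegaCoef u 0 = OmegaTot u - OmegaTot (fun ℓ => u ℓ.succ) := by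
  have h1 : (Finset.Ici (0 : Fin (m + 1))) = Finset.univ := by ext; simp
  have h2 : ∑ j ∈ Finset.Ioi (0 : Fin (m + 1)), u j = ∑ j : Fin m, u j.succ := by
    rw [Fin.Ioi_zero_eq_map, Finset.sum_map]; rfl
  rw [omegaCoef, OmegaTot, OmegaTot, h1, h2]

lemma omegaCoef_succ {m : ℕ} (u : Fin (m + 1) → ℝ) (ℓ : Fin m) :
    omegaCoef u ℓ.succ = omegaCoef (fun ℓ => u ℓ.succ) ℓ := by
  have h1 : ∑ j ∈ Finset.Ici ℓ.succ, u j = ∑ j ∈ Finset.Ici ℓ, u j.succ := by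
    rw [← Fin.map_succEmb_Ici, Finset.sum_map]; rfl
  have h2 : ∑ j ∈ Finset.Ioi ℓ.succ, u j = ∑ j ∈ Finset.Ioi ℓ, u j.succ := by
    rw [← Fin.map_succEmb_Ioi, Finset.sum_map]; rfl
  rw [omegaCoef, omegaCoef, h1, h2]

lemma sum_omegaCoef {m : ℕ} (u : Fin m → ℝ) : ∑ ℓ, omegaCoef u ℓ = OmegaTot u - 1 := by
  induction m with
  | zero => simp [OmegaTot]
  | succ m ih =>
    rw [Fin.sum_univ_succ, omegaCoef_zero]
    simp only [omegaCoef_succ, ih]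
    ring

lemma exp_neg_mul_one_sub_le_one_add_sum {m : ℕ} (u F : Fin m → ℝ) (hF : Monotone F)
    (hF1 : ∀ ℓ, F ℓ ≤ 1) {a : ℝ} (haF : ∀ ℓ, a ≤ F ℓ) :
    Real.exp (-∑ ℓ, |u ℓ|) * (1 - a)
      ≤ 1 + ∑ ℓ, omegaCoef u ℓ * F ℓ - a * OmegaTot u := by
  induction m generalizing a with
  | zero => simp [OmegaTot]
  | succ m ih =>
    have h := ih (fun ℓ => u ℓ.succ) (fun ℓ => F ℓ.succ)
      (fun i j hij => hF (Fin.succ_le_succ_iff.2 hij)) (fun ℓ => hF1 _)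
      (fun ℓ => hF (Fin.zero_le _))
    rw [Fin.sum_univ_succ (fun ℓ => omegaCoef u ℓ * F ℓ), omegaCoef_zero]
    simp only [omegaCoef_succ]
    have h1 : Real.exp (-∑ ℓ, |u ℓ|) ≤ Real.exp (-∑ ℓ : Fin m, |u ℓ.succ|) := by
      rw [Fin.sum_univ_succ]
      exact Real.exp_le_exp.2 (by linarith [abs_nonneg (u 0)])
    have h2 : Real.exp (-∑ ℓ, |u ℓ|) ≤ OmegaTot u := by
      refine Real.exp_le_exp.2 ?_
      rw [← Finset.sum_neg_distrib]
      exact Finset.sum_le_sum fun ℓ _ => neg_abs_le _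
    have h3 := mul_le_mul_of_nonneg_right h1 (sub_nonneg.2 (hF1 0))
    have h4 := mul_le_mul_of_nonneg_right h2 (sub_nonneg.2 (haF 0))
    linarith

lemma exp_neg_le_one_add_sum_omegaCoef_mul {m : ℕ} (u F : Fin m → ℝ) (hF : Monotone F)
    (hF0 : ∀ ℓ, 0 ≤ F ℓ) (hF1 : ∀ ℓ, F ℓ ≤ 1) :
    Real.exp (-∑ ℓ, |u ℓ|) ≤ 1 + ∑ ℓ, omegaCoef u ℓ * F ℓ := by
  simpa using exp_neg_mul_one_sub_le_one_add_sum u F hF hF1 hF0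

lemma exists_bound_of_contDiff {A : ℝ → ℝ} (hA : ContDiff ℝ 1 A) :
    ∃ K : ℝ, 0 ≤ K ∧ ∀ x : ℝ, 0 ≤ x → x ≤ 1 → |A x| ≤ K ∧ |deriv A x| ≤ K ∧ |A x - A 0| ≤ K * x := by
  obtain ⟨K₁, h₁⟩ := isCompact_Icc.exists_bound_of_continuousOn
    (s := Set.Icc (0:ℝ) 1) hA.continuous.continuousOn
  obtain ⟨K₂, h₂⟩ := isCompact_Icc.exists_bound_of_continuousOn
    (s := Set.Icc (0:ℝ) 1) (hA.continuous_deriv le_rfl).continuousOn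
  have h0 : (0:ℝ) ∈ Set.Icc (0:ℝ) 1 := ⟨le_rfl, zero_le_one⟩
  refine ⟨max K₁ K₂, (norm_nonneg _).trans ((h₁ 0 h0).trans (le_max_left _ _)),
    fun x hx hx1 => ⟨(h₁ x ⟨hx, hx1⟩).trans (le_max_left _ _),
      (h₂ x ⟨hx, hx1⟩).trans (le_max_right _ _), ?_⟩⟩
  have h := (convex_Icc (0:ℝ) 1).norm_image_sub_le_of_norm_hasDerivWithin_le
    (fun y _ => ((hA.differentiable one_ne_zero y).hasDerivAt).hasDerivWithinAt) h₂ h0 ⟨hx, hx1⟩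
  rw [sub_zero, Real.norm_of_nonneg hx] at h
  exact h.trans (mul_le_mul_of_nonneg_right (le_max_right _ _) hx)

lemma abs_log_sub_log_sub_div_le {c g G : ℝ} (hc : 0 < c) (hg : c ≤ g) (hG : c ≤ G) :
    |Real.log G - Real.log g - (G - g) / g| ≤ (G - g) ^ 2 / c ^ 2 := by
  have hg0 := hc.trans_le hg
  have hG0 := hc.trans_le hG
  have h1 := Real.log_le_sub_one_of_pos (div_pos hG0 hg0)
  have h2 := Real.one_sub_inv_le_log_of_pos (div_pos hG0 hg0)
  rw [Real.log_div hG0.ne' hg0.ne'] at h1 h2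
  have e1 : G / g - 1 = (G - g) / g := by field_simp
  have e2 : 1 - (G / g)⁻¹ = (G - g) / g - (G - g) ^ 2 / (g * G) := by field_simp; ring
  have h3 : (G - g) ^ 2 / (g * G) ≤ (G - g) ^ 2 / c ^ 2 := by
    rw [sq c]; gcongr
  have h4 : 0 ≤ (G - g) ^ 2 / c ^ 2 := by positivity
  rw [abs_le]
  constructor <;> linarith

noncomputable def weightedPrimitive (α Ω : ℝ) (A : ℝ → ℝ) (x : ℝ) : ℝ :=
  Ω + ∫ y in (0:ℝ)..x, y ^ (α - 1) * A y

lemma weightedPrimitive_zero (α Ω : ℝ) (A : ℝ → ℝ) : weightedPrimitive α Ω A 0 = Ω := by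
  simp [weightedPrimitive]

section

variable {α Ω c : ℝ} {A : ℝ → ℝ}

lemma continuous_weightedPrimitive (hα : 0 < α) (hA : Continuous A) :
    Continuous (weightedPrimitive α Ω A) :=
  continuous_const.add
    (intervalIntegral.continuous_primitive (fun a b => intervalIntegrable_rpow_mul hα hA a b) 0)

lemma hasDerivAt_weightedPrimitive (hα : 0 < α) (hA : Continuous A) {x : ℝ} (hx : 0 < x) :
    HasDerivAt (weightedPrimitive α Ω A) (x ^ (α - 1) * A x) x := by
  refine HasDerivAt.const_add Ω (intervalIntegral.integral_hasDerivAt_right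
    (intervalIntegrable_rpow_mul hα hA 0 x) ?_ ?_)
  · exact (Measurable.stronglyMeasurable
      ((measurable_id.pow_const _).mul hA.measurable)).stronglyMeasurableAtFilter
  · exact (Real.continuousAt_rpow_const x _ (Or.inl hx.ne')).mul hA.continuousAt

lemma exists_abs_weightedPrimitive_sub_le (hα : 0 < α) (hA : ContDiff ℝ 1 A) (Ω : ℝ) :
    ∃ K : ℝ, 0 ≤ K ∧ ∀ x : ℝ, 0 ≤ x → x ≤ 1 →
      |weightedPrimitive α Ω A x - Ω| ≤ K * x ^ α ∧
      |weightedPrimitive α Ω A x - Ω - A 0 / α * x ^ α| ≤ K * (x * x ^ α) := by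
  obtain ⟨K, hK0, hK⟩ := exists_bound_of_contDiff hA
  refine ⟨K / α, by positivity, fun x hx hx1 => ⟨?_, ?_⟩⟩
  · rw [weightedPrimitive, add_sub_cancel_left]
    refine (abs_integral_rpow_mul_le hα hx fun s hs hsx => (hK s hs (hsx.trans hx1)).1).trans
      (le_of_eq ?_)
    ring
  · have h := abs_integral_rpow_mul_le (f := fun s => A s - A 0) (K := K * x) hα hx
      fun s hs hsx => (hK s hs (hsx.trans hx1)).2.2.trans (by gcongr)
    have e : ∫ s in (0:ℝ)..x, s ^ (α - 1) * (A s - A 0)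
        = weightedPrimitive α Ω A x - Ω - A 0 / α * x ^ α := by
      simp only [mul_sub]
      rw [intervalIntegral.integral_sub (intervalIntegrable_rpow_mul hα hA.continuous 0 x)
        (intervalIntegrable_rpow_mul hα continuous_const 0 x), intervalIntegral.integral_mul_const,
        integral_rpow_sub_one hα, weightedPrimitive]
      ring
    rw [e] at h
    refine h.trans (le_of_eq ?_)
    ring

lemma exists_abs_log_weightedPrimitive_sub_le (hα : 0 < α) (hA : ContDiff ℝ 1 A) (hc : 0 < c)
    (hg : ∀ x, 0 ≤ x → x ≤ 1 → c ≤ weightedPrimitive α Ω A x) :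
    ∃ K : ℝ, 0 ≤ K ∧ ∀ x : ℝ, 0 ≤ x → x ≤ 1 →
      |Real.log (weightedPrimitive α Ω A x) - Real.log Ω - A 0 / (α * Ω) * x ^ α|
        ≤ K * (x ^ (2 * α) + x ^ (α + 1)) := by
  obtain ⟨K, hK0, hK⟩ := exists_abs_weightedPrimitive_sub_le hα hA Ω
  have hΩ : c ≤ Ω := weightedPrimitive_zero α Ω A ▸ hg 0 le_rfl zero_le_one
  have hΩ0 := hc.trans_le hΩ
  refine ⟨K ^ 2 / c ^ 2 + K / Ω, by positivity, fun x hx hx1 => ?_⟩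
  have h1 := abs_log_sub_log_sub_div_le hc hΩ (hg x hx hx1)
  obtain ⟨h2, h3⟩ := hK x hx hx1
  set g := weightedPrimitive α Ω A x
  have h4 : (g - Ω) ^ 2 ≤ K ^ 2 * x ^ (2 * α) := by
    rw [mul_comm 2 α, Real.rpow_mul hx, Real.rpow_two, ← mul_pow, ← sq_abs]
    gcongr
  have h5 : x * x ^ α = x ^ (α + 1) := by
    rw [Real.rpow_add_one' hx (by linarith), mul_comm]
  rw [h5] at h3
  have p1 : 0 ≤ x ^ (2 * α) := by positivity
  have p2 : 0 ≤ x ^ (α + 1) := by positivity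
  calc _ = |(Real.log g - Real.log Ω - (g - Ω) / Ω) + (g - Ω - A 0 / α * x ^ α) / Ω| := by
        congr 1; field_simp; ring
    _ ≤ (g - Ω) ^ 2 / c ^ 2 + K * x ^ (α + 1) / Ω := by
        refine (abs_add_le _ _).trans (add_le_add h1 ?_)
        rw [abs_div, abs_of_pos hΩ0]
        gcongr
    _ ≤ K ^ 2 * x ^ (2 * α) / c ^ 2 + K * x ^ (α + 1) / Ω := by gcongr
    _ = K ^ 2 / c ^ 2 * x ^ (2 * α) + K / Ω * x ^ (α + 1) := by ring
    _ ≤ _ := by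
        have : 0 ≤ K ^ 2 / c ^ 2 := by positivity
        have : 0 ≤ K / Ω := by positivity
        nlinarith [mul_nonneg ‹0 ≤ K ^ 2 / c ^ 2› p2, mul_nonneg ‹0 ≤ K / Ω› p1]

lemma exists_abs_div_weightedPrimitive_sub_le {P : ℝ → ℝ} (hα : 0 < α) (hA : ContDiff ℝ 1 A)
    (hP : ContDiff ℝ 1 P) (hc : 0 < c)
    (hg : ∀ x, 0 ≤ x → x ≤ 1 → c ≤ weightedPrimitive α Ω A x) :
    ∃ K : ℝ, 0 ≤ K ∧ ∀ x : ℝ, 0 ≤ x → x ≤ 1 →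
      |P x / weightedPrimitive α Ω A x - P 0 / Ω| ≤ K * (x + x ^ α) := by
  obtain ⟨K, hK0, hK⟩ := exists_abs_weightedPrimitive_sub_le hα hA Ω
  obtain ⟨L, hL0, hL⟩ := exists_bound_of_contDiff hP
  have hΩ : c ≤ Ω := weightedPrimitive_zero α Ω A ▸ hg 0 le_rfl zero_le_one
  have hΩ0 := hc.trans_le hΩ
  refine ⟨L / c + L * K / (c * c), by positivity, fun x hx hx1 => ?_⟩
  have h1 := (hK x hx hx1).1
  have h2 := (hL x hx hx1).2.2
  have h3 := (hL 0 le_rfl zero_le_one).1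
  have h4 := hg x hx hx1
  set g := weightedPrimitive α Ω A x
  have hg0 := hc.trans_le h4
  have p1 : 0 ≤ x ^ α := by positivity
  calc _ = |(P x - P 0) / g - P 0 * (g - Ω) / (g * Ω)| := by congr 1; field_simp; ring
    _ ≤ |P x - P 0| / g + |P 0| * |g - Ω| / (g * Ω) := by
        refine (abs_sub _ _).trans (le_of_eq ?_)
        rw [abs_div, abs_div, abs_mul, abs_of_pos hg0, abs_of_pos (mul_pos hg0 hΩ0)]
    _ ≤ L * x / c + L * (K * x ^ α) / (c * c) := by gcongr
    _ = L / c * x + L * K / (c * c) * x ^ α := by ring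
    _ ≤ _ := by
        have q1 : 0 ≤ L / c := by positivity
        have q2 : 0 ≤ L * K / (c * c) := by positivity
        nlinarith [mul_nonneg q1 p1, mul_nonneg q2 hx]

lemma exists_hasDerivAt_rpow_mul_div_weightedPrimitive {P : ℝ → ℝ} (hα : 0 < α)
    (hA : ContDiff ℝ 1 A) (hP : ContDiff ℝ 1 P) (hc : 0 < c)
    (hg : ∀ x, 0 ≤ x → x ≤ 1 → c ≤ weightedPrimitive α Ω A x) :
    ∃ (f' : ℝ → ℝ) (K : ℝ),
      (∀ x, 0 < x → x ≤ 1 →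
        HasDerivAt (fun x => x ^ (α - 1) * P x / weightedPrimitive α Ω A x) (f' x) x) ∧
      ∀ x, 0 < x → x ≤ 1 → |f' x| ≤ K * envelope α x := by
  obtain ⟨K, hK0, hK⟩ := exists_bound_of_contDiff hA
  obtain ⟨L, hL0, hL⟩ := exists_bound_of_contDiff hP
  obtain ⟨C₁, hC₁0, hC₁⟩ := exists_rpow_le_envelope (α := α) (β := α - 1) (by linarith)
    (fun h => by linarith)
  obtain ⟨C₂, hC₂0, hC₂⟩ := exists_rpow_le_envelope (α := α) (β := (α - 1) + (α - 1))
    (by linarith) (fun h => by linarith)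
  refine ⟨fun x => (((α - 1) * x ^ (α - 1 - 1) * P x + x ^ (α - 1) * deriv P x)
      * weightedPrimitive α Ω A x - x ^ (α - 1) * P x * (x ^ (α - 1) * A x))
      / weightedPrimitive α Ω A x ^ 2, L / c + C₁ * L / c + C₂ * (L * K) / c ^ 2,
    fun x hx hx1 => ?_, fun x hx hx1 => ?_⟩
  · exact ((Real.hasDerivAt_rpow_const (Or.inl hx.ne')).mul
      (hP.differentiable one_ne_zero x).hasDerivAt).div
      (hasDerivAt_weightedPrimitive hα hA.continuous hx) (hc.trans_le (hg x hx.le hx1)).ne'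
  · beta_reduce
    have h1 := (hK x hx.le hx1).1
    obtain ⟨h2, h3, -⟩ := hL x hx.le hx1
    have h4 := hg x hx.le hx1
    have h5 := hC₁ x hx hx1
    have h6 := hC₂ x hx hx1
    have h7 : |α - 1| * x ^ (α - 2) ≤ envelope α x := by unfold envelope; linarith
    rw [Real.rpow_add hx] at h6
    set g := weightedPrimitive α Ω A x
    have hg0 := hc.trans_le h4
    have hE := envelope_pos α hx
    have p1 : 0 < x ^ (α - 2) := by positivity
    have p2 : 0 < x ^ (α - 1) := by positivity
    rw [show α - 1 - 1 = α - 2 by ring]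
    calc _ = |(α - 1) * x ^ (α - 2) * P x / g + x ^ (α - 1) * deriv P x / g
            - x ^ (α - 1) * x ^ (α - 1) * (P x * A x) / g ^ 2| := by
          congr 1; field_simp
      _ ≤ |α - 1| * x ^ (α - 2) * |P x| / g + x ^ (α - 1) * |deriv P x| / g
            + x ^ (α - 1) * x ^ (α - 1) * (|P x| * |A x|) / g ^ 2 := by
          refine (abs_sub _ _).trans ((add_le_add_left (abs_add_le _ _) _).trans (le_of_eq ?_))
          simp only [abs_div, abs_mul, abs_of_pos hg0, abs_of_pos p1, abs_of_pos p2, abs_pow]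
      _ ≤ envelope α x * L / c + C₁ * envelope α x * L / c
            + C₂ * envelope α x * (L * K) / c ^ 2 := by gcongr
      _ = _ := by ring

end

section

variable {α Ω c : ℝ} {A : ℝ → ℝ}

lemma continuousOn_log_weightedPrimitive (hα : 0 < α) (hA : ContDiff ℝ 1 A) (hc : 0 < c)
    (hg : ∀ x, 0 ≤ x → x ≤ 1 → c ≤ weightedPrimitive α Ω A x) :
    ContinuousOn (fun x => Real.log (weightedPrimitive α Ω A x)) (Set.Icc 0 1) :=
  (continuous_weightedPrimitive hα hA.continuous).continuousOn.log
    fun x hx => (hc.trans_le (hg x hx.1 hx.2)).ne'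

lemma exists_abs_integral_log_weightedPrimitive_sub_le (hα : 0 < α) (hA : ContDiff ℝ 1 A)
    (hc : 0 < c) (hg : ∀ x, 0 ≤ x → x ≤ 1 → c ≤ weightedPrimitive α Ω A x) :
    ∃ K : ℝ, 0 ≤ K ∧ ∀ a : ℝ, 0 ≤ a → a ≤ 1 →
      |(∫ x in (0:ℝ)..a, Real.log (weightedPrimitive α Ω A x)) - a * Real.log Ω
          - A 0 / (α * (α + 1) * Ω) * a ^ (α + 1)|
        ≤ K * (a ^ (1 + 2 * α) + a ^ (2 + α)) := by
  obtain ⟨K, hK0, hK⟩ := exists_abs_log_weightedPrimitive_sub_le hα hA hc hg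
  refine ⟨K, hK0, fun a ha ha1 => ?_⟩
  have hΩ : c ≤ Ω := weightedPrimitive_zero α Ω A ▸ hg 0 le_rfl zero_le_one
  have hΩ0 := hc.trans_le hΩ
  have h := intervalIntegral.norm_integral_le_of_norm_le_const (a := 0) (b := a)
    (f := fun x => Real.log (weightedPrimitive α Ω A x) - Real.log Ω - A 0 / (α * Ω) * x ^ α)
    (C := K * (a ^ (2 * α) + a ^ (α + 1))) fun x hx => by
      rw [Set.uIoc_of_le ha] at hx
      refine (hK x hx.1.le (hx.2.trans ha1)).trans ?_
      have := hx.1.le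
      have := hx.2
      gcongr
  have hi : IntervalIntegrable (fun x => Real.log (weightedPrimitive α Ω A x)) volume 0 a :=
    ContinuousOn.intervalIntegrable_of_Icc ha
      ((continuousOn_log_weightedPrimitive hα hA hc hg).mono (Set.Icc_subset_Icc le_rfl ha1))
  have e : ∫ x in (0:ℝ)..a,
      (Real.log (weightedPrimitive α Ω A x) - Real.log Ω - A 0 / (α * Ω) * x ^ α)
      = (∫ x in (0:ℝ)..a, Real.log (weightedPrimitive α Ω A x)) - a * Real.log Ω
          - A 0 / (α * (α + 1) * Ω) * a ^ (α + 1) := by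
    rw [intervalIntegral.integral_sub (hi.sub (by simp))
      ((intervalIntegral.intervalIntegrable_rpow' (by linarith)).const_mul _),
      intervalIntegral.integral_sub hi (by simp), intervalIntegral.integral_const_mul,
      integral_rpow (Or.inl (by linarith)), Real.zero_rpow (by linarith)]
    simp only [intervalIntegral.integral_const, smul_eq_mul, sub_zero]
    have : α + 1 ≠ 0 := by linarith
    field_simp
  rw [e, sub_zero, abs_of_nonneg ha] at h
  refine h.trans (le_of_eq ?_)
  have e1 : a ^ (1 + 2 * α) = a ^ (2 * α) * a := by
    rw [add_comm, Real.rpow_add_one' ha (by linarith)]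
  have e2 : a ^ (2 + α) = a ^ (α + 1) * a := by
    rw [show 2 + α = α + 1 + 1 by ring, Real.rpow_add_one' ha (by linarith)]
  rw [e1, e2]
  ring

lemma intervalIntegrable_rpow_mul_div_weightedPrimitive {P : ℝ → ℝ} (hα : 0 < α)
    (hA : ContDiff ℝ 1 A) (hP : ContDiff ℝ 1 P) (hc : 0 < c)
    (hg : ∀ x, 0 ≤ x → x ≤ 1 → c ≤ weightedPrimitive α Ω A x) :
    IntervalIntegrable (fun x => x ^ (α - 1) * P x / weightedPrimitive α Ω A x) volume 0 1 := by
  simp only [mul_div_assoc]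
  refine (intervalIntegral.intervalIntegrable_rpow' (by linarith)).mul_continuousOn ?_
  rw [Set.uIcc_of_le zero_le_one]
  exact hP.continuous.continuousOn.div (continuous_weightedPrimitive hα hA.continuous).continuousOn
    fun x hx => (hc.trans_le (hg x hx.1 hx.2)).ne'

lemma exists_abs_integral_rpow_mul_div_weightedPrimitive_sub_le {P : ℝ → ℝ} (hα : 0 < α)
    (hA : ContDiff ℝ 1 A) (hP : ContDiff ℝ 1 P) (hc : 0 < c)
    (hg : ∀ x, 0 ≤ x → x ≤ 1 → c ≤ weightedPrimitive α Ω A x) :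
    ∃ K : ℝ, 0 ≤ K ∧ ∀ a : ℝ, 0 ≤ a → a ≤ 1 →
      |(∫ x in (0:ℝ)..a, x ^ (α - 1) * P x / weightedPrimitive α Ω A x)
          - P 0 / (α * Ω) * a ^ α| ≤ K * (a ^ (2 * α) + a ^ (α + 1)) := by
  obtain ⟨K, hK0, hK⟩ := exists_abs_div_weightedPrimitive_sub_le hα hA hP hc hg
  refine ⟨K / α, by positivity, fun a ha ha1 => ?_⟩
  have h := abs_integral_rpow_mul_le (f := fun x => P x / weightedPrimitive α Ω A x - P 0 / Ω)
    (K := K * (a + a ^ α)) hα ha fun s hs hsa =>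
      (hK s hs (hsa.trans ha1)).trans (by gcongr)
  have hi := (intervalIntegrable_rpow_mul_div_weightedPrimitive hα hA hP hc hg).mono_set
    (Set.uIcc_subset_uIcc (Set.left_mem_uIcc) (by rw [Set.uIcc_of_le zero_le_one]; exact ⟨ha, ha1⟩) :
      Set.uIcc 0 a ⊆ Set.uIcc 0 1)
  have e : ∫ x in (0:ℝ)..a, x ^ (α - 1) * (P x / weightedPrimitive α Ω A x - P 0 / Ω)
      = (∫ x in (0:ℝ)..a, x ^ (α - 1) * P x / weightedPrimitive α Ω A x)
          - P 0 / (α * Ω) * a ^ α := by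
    simp only [mul_sub, ← mul_div_assoc]
    rw [intervalIntegral.integral_sub hi (by
        simp only [mul_div_assoc]; exact intervalIntegrable_rpow_mul hα continuous_const 0 a)]
    simp only [mul_div_assoc]
    rw [intervalIntegral.integral_mul_const, integral_rpow_sub_one hα]
    have hΩ : Ω ≠ 0 := by
      have := hg 0 le_rfl zero_le_one
      rw [weightedPrimitive_zero] at this
      exact (hc.trans_le this).ne'
    field_simp
  rw [e] at h
  refine h.trans (le_of_eq ?_)
  rw [Real.rpow_add_one' ha (by linarith), mul_comm 2 α, Real.rpow_mul ha, Real.rpow_two]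
  ring

lemma exists_abs_sum_log_weightedPrimitive_sub_le {P : ℝ → ℝ} (hα : 0 < α)
    (hA : ContDiff ℝ 1 A) (hP : ContDiff ℝ 1 P) (hc : 0 < c)
    (hg : ∀ x, 0 ≤ x → x ≤ 1 → c ≤ weightedPrimitive α Ω A x) :
    ∃ C : ℝ, 0 ≤ C ∧ ∀ n N : ℕ, 1 ≤ N → N ≤ n →
      |∑ j ∈ Finset.Icc N n, (Real.log (weightedPrimitive α Ω A (j / n))
          + ((j:ℝ) / n) ^ (α - 1) * P (j / n) / weightedPrimitive α Ω A (j / n) / n)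
        - (n * ((∫ x in (0:ℝ)..1, Real.log (weightedPrimitive α Ω A x)) - (N / n) * Real.log Ω
            - A 0 / (α * (α + 1) * Ω) * ((N:ℝ) / n) ^ (α + 1))
          + (∫ x in (0:ℝ)..1, x ^ (α - 1) * P x / weightedPrimitive α Ω A x)
          + (Real.log (weightedPrimitive α Ω A 1) + Real.log Ω) / 2
          + (A 0 / 2 - P 0) / (α * Ω) * ((N:ℝ) / n) ^ α)|
        ≤ C * (n * ((N:ℝ) / n) ^ (1 + 2 * α) + n * ((N:ℝ) / n) ^ (2 + α)
            + (1 + ((N:ℝ) / n) ^ (α - 1)) / n) := by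
  obtain ⟨φA', KA, hφA, hφA'⟩ := exists_hasDerivAt_rpow_mul_div_weightedPrimitive hα hA hA hc hg
  obtain ⟨φP', KP, hφP, hφP'⟩ := exists_hasDerivAt_rpow_mul_div_weightedPrimitive hα hA hP hc hg
  obtain ⟨C₁, hC₁0, hC₁⟩ := exists_abs_sum_sub_trapezoid_le
    (f := fun x => Real.log (weightedPrimitive α Ω A x))
    (fun x hx hx1 => (hasDerivAt_weightedPrimitive hα hA.continuous hx).log
      (hc.trans_le (hg x hx.le hx1)).ne') hφA hφA'
  obtain ⟨C₂, hC₂0, hC₂⟩ := exists_abs_sum_sub_integral_le hφP hφP'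
  obtain ⟨C₃, hC₃0, hC₃⟩ := exists_abs_log_weightedPrimitive_sub_le hα hA hc hg
  obtain ⟨C₄, hC₄0, hC₄⟩ := exists_abs_integral_log_weightedPrimitive_sub_le hα hA hc hg
  obtain ⟨C₅, hC₅0, hC₅⟩ :=
    exists_abs_integral_rpow_mul_div_weightedPrimitive_sub_le hα hA hP hc hg
  refine ⟨C₁ + C₂ + C₃ + C₄ + C₅, by positivity, fun n N hN hNn => ?_⟩
  have hn : (0:ℝ) < n := by exact_mod_cast (show 0 < n by omega)
  have hN' : (1:ℝ) ≤ N := by exact_mod_cast hN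
  have h1 := hC₁ n N hN hNn
  have h2 := hC₂ n N hN hNn
  have hna : (1:ℝ) ≤ n * ((N:ℝ) / n) := by rw [mul_div_cancel₀ _ hn.ne']; exact hN'
  have ha1 : (N:ℝ) / n ≤ 1 := by rw [div_le_one hn]; exact_mod_cast hNn
  have ha : 0 < (N:ℝ) / n := by positivity
  set a := (N:ℝ) / n with ha_def
  have h3 := hC₃ a ha.le ha1
  have h4 := hC₄ a ha.le ha1
  have h5 := hC₅ a ha.le ha1
  have hi₀ : IntervalIntegrable (fun x => Real.log (weightedPrimitive α Ω A x)) volume 0 1 :=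
    ContinuousOn.intervalIntegrable_of_Icc zero_le_one
      (continuousOn_log_weightedPrimitive hα hA hc hg)
  have hi₁ := intervalIntegrable_rpow_mul_div_weightedPrimitive hα hA hP hc hg
  have hau : a ∈ Set.uIcc (0:ℝ) 1 := by rw [Set.uIcc_of_le zero_le_one]; exact ⟨ha.le, ha1⟩
  have s1 : Set.uIcc 0 a ⊆ Set.uIcc (0:ℝ) 1 := Set.uIcc_subset_uIcc Set.left_mem_uIcc hau
  have s2 : Set.uIcc a 1 ⊆ Set.uIcc (0:ℝ) 1 := Set.uIcc_subset_uIcc hau Set.right_mem_uIcc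
  have a0 := intervalIntegral.integral_add_adjacent_intervals (hi₀.mono_set s1) (hi₀.mono_set s2)
  have a1 := intervalIntegral.integral_add_adjacent_intervals (hi₁.mono_set s1) (hi₁.mono_set s2)
  have e1 : a ^ (1 + 2 * α) = a ^ (2 * α) * a := by
    rw [add_comm, Real.rpow_add_one' ha.le (by linarith)]
  have e2 : a ^ (2 + α) = a ^ (α + 1) * a := by
    rw [show 2 + α = α + 1 + 1 by ring, Real.rpow_add_one' ha.le (by linarith)]
  set X := n * a ^ (1 + 2 * α) + n * a ^ (2 + α) with hX
  set Y := (1 + a ^ (α - 1)) / n with hY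
  have hY0 : 0 ≤ Y := by positivity
  have hX0 : 0 ≤ X := by positivity
  have hZ : a ^ (2 * α) + a ^ (α + 1) ≤ X := by
    have p1 : 0 ≤ a ^ (2 * α) := by positivity
    have p2 : 0 ≤ a ^ (α + 1) := by positivity
    rw [hX, e1, e2]
    nlinarith [mul_le_mul_of_nonneg_left hna p1, mul_le_mul_of_nonneg_left hna p2]
  have h4' := mul_le_mul_of_nonneg_left h4 hn.le
  rw [← abs_of_pos hn, ← abs_mul, abs_of_pos hn] at h4'
  have h4'' : n * (C₄ * (a ^ (1 + 2 * α) + a ^ (2 + α))) = C₄ * X := by rw [hX]; ring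
  rw [h4''] at h4'
  have h3' := h3.trans (mul_le_mul_of_nonneg_left hZ hC₃0)
  have h5' := h5.trans (mul_le_mul_of_nonneg_left hZ hC₅0)
  rw [Finset.sum_add_distrib]
  have hfin : (C₁ + C₂ + C₃ + C₄ + C₅) * (X + Y)
      = C₁ * Y + C₂ * Y + C₃ * X + C₄ * X + C₅ * X
        + (C₁ * X + C₂ * X + C₃ * Y + C₄ * Y + C₅ * Y) := by ring
  have hrest : 0 ≤ C₁ * X + C₂ * X + C₃ * Y + C₄ * Y + C₅ * Y := by positivity
  have hh : 0 ≤ C₃ * X := by positivity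
  rw [hfin]
  rw [abs_le] at *
  have eA : A 0 / (α * Ω) * a ^ α / 2 - P 0 / (α * Ω) * a ^ α
    = (A 0 / 2 - P 0) / (α * Ω) * a ^ α := by ring
  have a0' := congrArg (fun z => (n:ℝ) * z) a0
  simp only [mul_add] at a0'
  simp only [mul_sub] at *
  constructor <;> linarith
end

lemma envelope_div_sq_le {α : ℝ} (hα : 0 < α) {n j : ℕ} (hj : 1 ≤ j) (hjn : j ≤ n) :
    envelope α ((j:ℝ) / n) / (n:ℝ) ^ 2 ≤ |α - 1| + 1 := by
  have hj1 : (1:ℝ) ≤ j := by exact_mod_cast hj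
  have hn1 : (1:ℝ) ≤ n := by exact_mod_cast hj.trans hjn
  have hx0 : 0 < (j:ℝ) / n := by positivity
  have hx1 : (j:ℝ) / n ≤ 1 := by rw [div_le_one (by positivity)]; exact_mod_cast hjn
  have h1 : ((j:ℝ) / n) ^ (α - 2) ≤ (n:ℝ) ^ 2 := by
    rw [Real.rpow_sub hx0, Real.rpow_two, div_pow, div_div_eq_mul_div]
    have h2 := Real.rpow_le_one hx0.le hx1 hα.le
    have h3 : (1:ℝ) ≤ (j:ℝ) ^ 2 := one_le_pow₀ hj1
    have h4 : 0 ≤ ((j:ℝ) / n) ^ α := by positivity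
    rw [div_le_iff₀ (by positivity)]
    nlinarith [sq_nonneg (n:ℝ)]
  have h5 : (1:ℝ) ≤ (n:ℝ) ^ 2 := one_le_pow₀ hn1
  rw [div_le_iff₀ (by positivity), envelope]
  nlinarith [mul_le_mul_of_nonneg_left h1 (abs_nonneg (α - 1))]

section

variable {m : ℕ}

noncomputable def sigmaZeroDensity (α : ℝ) (t u : Fin m → ℝ) (x : ℝ) : ℝ :=
  ∑ ℓ, -(omegaCoef u ℓ * (t ℓ ^ α / Real.Gamma α)) * Real.exp (-(t ℓ * x))

noncomputable def sigmaOneFactor (α : ℝ) (t u : Fin m → ℝ) (x : ℝ) : ℝ :=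
  ∑ ℓ, omegaCoef u ℓ * (Real.exp (-(t ℓ * x)) * t ℓ ^ α / Real.Gamma α) * ((1 - α - t ℓ * x) / 2)

variable {α : ℝ} {t u : Fin m → ℝ}

lemma contDiff_sigmaZeroDensity : ContDiff ℝ 1 (sigmaZeroDensity α t u) := by
  unfold sigmaZeroDensity
  fun_prop

lemma contDiff_sigmaOneFactor : ContDiff ℝ 1 (sigmaOneFactor α t u) := by
  unfold sigmaOneFactor
  fun_prop

lemma sigmaZeroDensity_zero : sigmaZeroDensity α t u 0 = -(Tzero α t u / Real.Gamma α) := by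
  simp only [sigmaZeroDensity, Tzero, mul_zero, neg_zero, Real.exp_zero, mul_one,
    Finset.sum_neg_distrib, Finset.sum_div, mul_div_assoc]

lemma sigmaOneFactor_zero :
    sigmaOneFactor α t u 0 = Tzero α t u / Real.Gamma α * ((1 - α) / 2) := by
  simp only [sigmaOneFactor, Tzero, mul_zero, neg_zero, Real.exp_zero, one_mul, sub_zero,
    Finset.sum_div, Finset.sum_mul, mul_div_assoc]

lemma one_add_SigmaZero (hα : 0 < α) (ht0 : ∀ ℓ, 0 ≤ t ℓ) {x : ℝ} (hx : 0 ≤ x) :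
    1 + SigmaZero α t u x = weightedPrimitive α (OmegaTot u) (sigmaZeroDensity α t u) x := by
  have h1 : ∫ y in (0:ℝ)..x, y ^ (α - 1) * sigmaZeroDensity α t u y
      = -∑ ℓ, omegaCoef u ℓ * (1 - Qfun α (t ℓ * x)) := by
    simp only [sigmaZeroDensity, Finset.mul_sum]
    rw [intervalIntegral.integral_finsetSum fun ℓ _ =>
        intervalIntegrable_rpow_mul hα (by fun_prop) 0 x, ← Finset.sum_neg_distrib]
    refine Finset.sum_congr rfl fun ℓ _ => ?_
    rw [one_sub_Qfun_mul hα (ht0 ℓ) hx, ← intervalIntegral.integral_const_mul,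
      ← intervalIntegral.integral_const_mul, ← intervalIntegral.integral_neg]
    congr 1
    ext y
    ring
  rw [weightedPrimitive, h1]
  simp only [mul_sub, mul_one, Finset.sum_sub_distrib, sum_omegaCoef, SigmaZero]
  ring

lemma exp_neg_le_one_add_SigmaZero (hα : 0 < α) (ht : Antitone t) (ht0 : ∀ ℓ, 0 ≤ t ℓ)
    {x : ℝ} (hx : 0 ≤ x) : Real.exp (-∑ ℓ, |u ℓ|) ≤ 1 + SigmaZero α t u x :=
  exp_neg_le_one_add_sum_omegaCoef_mul u _
    (fun _ j hij => Qfun_antitone hα (mul_nonneg (ht0 j) hx)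
      (mul_le_mul_of_nonneg_right (ht hij) hx))
    (fun ℓ => Qfun_nonneg hα (mul_nonneg (ht0 ℓ) hx))
    (fun ℓ => Qfun_le_one hα (mul_nonneg (ht0 ℓ) hx))

lemma exp_neg_le_one_add_sum_normIncBeta (hα : 0 < α) (ht : Antitone t) (ht0 : ∀ ℓ, 0 ≤ t ℓ)
    {n j : ℕ} (hj : 1 ≤ j) (htn : ∀ ℓ, t ℓ ≤ n) :
    Real.exp (-∑ ℓ, |u ℓ|) ≤ 1 + ∑ ℓ, omegaCoef u ℓ * normIncBeta (1 - t ℓ / n) j α := by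
  have h0 : ∀ ℓ, 0 ≤ 1 - t ℓ / n := fun ℓ =>
    sub_nonneg.2 (div_le_one_of_le₀ (htn ℓ) n.cast_nonneg)
  have h1 : ∀ ℓ, 1 - t ℓ / n ≤ 1 := fun ℓ => by
    have := ht0 ℓ
    exact sub_le_self _ (by positivity)
  refine exp_neg_le_one_add_sum_omegaCoef_mul u _ (fun i k hik => ?_)
    (fun ℓ => normIncBeta_nonneg hα hj (h0 ℓ) (h1 ℓ))
    (fun ℓ => normIncBeta_le_one hα hj (h0 ℓ) (h1 ℓ))
  refine normIncBeta_mono hα hj (h0 i) ?_ (h1 k)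
  have := ht hik
  gcongr

lemma exists_abs_sum_normIncBeta_sub_le (hα : 0 < α) (ht0 : ∀ ℓ, 0 ≤ t ℓ) :
    ∃ C : ℝ, 0 ≤ C ∧ ∀ n j : ℕ, (∀ ℓ, 2 * t ℓ ≤ n) → 1 ≤ j → j ≤ n →
      |(1 + ∑ ℓ, omegaCoef u ℓ * normIncBeta (1 - t ℓ / n) j α)
        - (1 + SigmaZero α t u (j / n)) - SigmaOne α t u (j / n) / n|
        ≤ C * (envelope α ((j:ℝ) / n) / (n : ℝ) ^ 2) := by
  choose C hC0 hC using fun ℓ => exists_abs_normIncBeta_sub_le hα (ht0 ℓ)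
  refine ⟨∑ ℓ, |omegaCoef u ℓ| * C ℓ,
    Finset.sum_nonneg fun ℓ _ => mul_nonneg (abs_nonneg _) (hC0 ℓ), fun n j hn hj hjn => ?_⟩
  have e : (1 + ∑ ℓ, omegaCoef u ℓ * normIncBeta (1 - t ℓ / n) j α)
        - (1 + SigmaZero α t u (j / n)) - SigmaOne α t u (j / n) / n
      = ∑ ℓ, omegaCoef u ℓ * (normIncBeta (1 - t ℓ / n) j α - Qfun α (t ℓ * (j / n))
        - ((j:ℝ) / n) ^ (α - 1) * (Real.exp (-(t ℓ * (j / n))) * t ℓ ^ α / Real.Gamma α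
          * ((1 - α - t ℓ * (j / n)) / 2)) / n) := by
    simp only [SigmaZero, SigmaOne, mul_sub, Finset.sum_sub_distrib, Finset.mul_sum,
      Finset.sum_div, add_sub_add_left_eq_sub]
    congr 1
    refine Finset.sum_congr rfl fun ℓ _ => ?_
    ring
  rw [e, Finset.sum_mul]
  refine (Finset.abs_sum_le_sum_abs _ _).trans (Finset.sum_le_sum fun ℓ _ => ?_)
  rw [abs_mul, mul_assoc]
  exact mul_le_mul_of_nonneg_left (hC ℓ n j (hn ℓ) hj hjn) (abs_nonneg _)

lemma exists_abs_log_sum_normIncBeta_sub_le (hα : 0 < α) (ht : Antitone t)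
    (ht0 : ∀ ℓ, 0 ≤ t ℓ) :
    ∃ C : ℝ, 0 ≤ C ∧ ∀ n j : ℕ, (∀ ℓ, 2 * t ℓ ≤ n) → 1 ≤ j → j ≤ n →
      |Real.log (1 + ∑ ℓ, omegaCoef u ℓ * normIncBeta (1 - t ℓ / n) j α)
        - (fZero α t u (j / n) + fOne α t u (j / n) / n)|
        ≤ C * (envelope α ((j:ℝ) / n) / (n : ℝ) ^ 2) := by
  obtain ⟨C, hC0, hC⟩ := exists_abs_sum_normIncBeta_sub_le (u := u) hα ht0
  obtain ⟨L, hL0, hL⟩ := exists_bound_of_contDiff (contDiff_sigmaOneFactor (α := α) (t := t) (u := u))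
  obtain ⟨B, hB0, hB⟩ := exists_rpow_le_envelope (α := α) (β := (α - 1) + (α - 1))
    (by linarith) (fun h => by linarith)
  set c := Real.exp (-∑ ℓ, |u ℓ|) with hc
  have hc0 : 0 < c := Real.exp_pos _
  refine ⟨(2 * (L ^ 2 * B) + 2 * (C ^ 2 * (|α - 1| + 1))) / c ^ 2 + C / c, by positivity,
    fun n j hn hj hjn => ?_⟩
  have h0 := hC n j hn hj hjn
  have hj0 : (0:ℝ) < j := by exact_mod_cast hj
  have hn0 : (0:ℝ) < n := by exact_mod_cast hj.trans hjn
  have hE := envelope_div_sq_le hα hj hjn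
  have hx0 : 0 < (j:ℝ) / n := by positivity
  have hx1 : (j:ℝ) / n ≤ 1 := by rw [div_le_one hn0]; exact_mod_cast hjn
  set x := (j:ℝ) / n with hx
  have hg := exp_neg_le_one_add_SigmaZero (u := u) hα ht ht0 hx0.le
  have hG := exp_neg_le_one_add_sum_normIncBeta (u := u) hα ht ht0 hj
    fun ℓ => by linarith [hn ℓ, ht0 ℓ]
  have hE0 := envelope_pos α hx0
  have hB' := hB x hx0 hx1
  rw [Real.rpow_add hx0, ← sq] at hB'
  have hS : SigmaOne α t u x ^ 2 ≤ L ^ 2 * (B * envelope α x) := by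
    have e : SigmaOne α t u x = x ^ (α - 1) * sigmaOneFactor α t u x := rfl
    rw [e, mul_pow, mul_comm]
    have := (hL x hx0.le hx1).1
    have h2 : sigmaOneFactor α t u x ^ 2 ≤ L ^ 2 := by rw [← sq_abs]; gcongr
    gcongr
  rw [fZero, fOne]
  set G := 1 + ∑ ℓ, omegaCoef u ℓ * normIncBeta (1 - t ℓ / n) j α
  set g := 1 + SigmaZero α t u x
  set S := SigmaOne α t u x
  set e := envelope α x / (n:ℝ) ^ 2 with he
  have he0 : 0 < e := by positivity
  have h1 := abs_log_sub_log_sub_div_le hc0 hg hG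
  have hg0 := hc0.trans_le hg
  have h2 : (G - g) ^ 2 ≤ (2 * (L ^ 2 * B) + 2 * (C ^ 2 * (|α - 1| + 1))) * e := by
    have h3 : (G - g - S / n) ^ 2 ≤ C ^ 2 * (|α - 1| + 1) * e := by
      calc _ ≤ (C * e) ^ 2 := by rw [← sq_abs]; gcongr
        _ = C ^ 2 * e * e := by ring
        _ ≤ C ^ 2 * (|α - 1| + 1) * e := by gcongr
    have h4 : (S / n) ^ 2 ≤ L ^ 2 * B * e := by
      calc _ = S ^ 2 / (n:ℝ) ^ 2 := by ring
        _ ≤ L ^ 2 * (B * envelope α x) / (n:ℝ) ^ 2 := by gcongr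
        _ = _ := by rw [he]; ring
    nlinarith [sq_nonneg (G - g - S / n - S / n)]
  calc _ = |(Real.log G - Real.log g - (G - g) / g) + (G - g - S / n) / g| := by
        congr 1; field_simp; ring
    _ ≤ (2 * (L ^ 2 * B) + 2 * (C ^ 2 * (|α - 1| + 1))) * e / c ^ 2 + C * e / c := by
        refine (abs_add_le _ _).trans (add_le_add (h1.trans (by gcongr)) ?_)
        rw [abs_div, abs_of_pos hg0]
        gcongr
    _ = _ := by ring

end

theorem statement19 (m : ℕ) (hm : 0 < m) (α : ℝ) (hα : 0 < α)
    (t u : Fin m → ℝ) (ht : StrictAnti t) (ht0 : ∀ ℓ, 0 ≤ t ℓ) :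
    ∃ C > (0:ℝ), ∃ n₀ : ℕ, ∀ n ≥ n₀,
      |(∑ j ∈ Finset.Icc (⌈(n : ℝ) ^ (α / (2 + α))⌉₊) n,
          Real.log (1 + ∑ ℓ : Fin m,
            omegaCoef u ℓ * normIncBeta (Real.sqrt (1 - t ℓ / n) ^ 2) j α))
        - ((n : ℝ) * ((∫ x in (0:ℝ)..1, fZero α t u x)
              - (1 / Mpar n α) * Real.log (OmegaTot u)
              + (Tzero α t u / (OmegaTot u * Real.Gamma (α + 2))) * Mpar n α ^ (-(α + 1)))
            + (∫ x in (0:ℝ)..1, fOne α t u x)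
            + (fZero α t u 1 + Real.log (OmegaTot u)) / 2
            - ((2 - α) * Tzero α t u / (2 * OmegaTot u * Real.Gamma (α + 1)))
                * Mpar n α ^ (-α))|
        ≤ C * ((n : ℝ) / Mpar n α ^ (1 + 2 * α) + (n : ℝ) / Mpar n α ^ (2 + α)
            + (1 + Mpar n α ^ (1 - α)) / n) := by
  have hg : ∀ x, 0 ≤ x → x ≤ 1 → Real.exp (-∑ ℓ, |u ℓ|)
      ≤ weightedPrimitive α (OmegaTot u) (sigmaZeroDensity α t u) x := fun x hx _ =>
    one_add_SigmaZero (u := u) hα ht0 hx ▸ exp_neg_le_one_add_SigmaZero hα ht.antitone ht0 hx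
  obtain ⟨C₁, hC₁0, hC₁⟩ := exists_abs_sum_log_weightedPrimitive_sub_le hα
    contDiff_sigmaZeroDensity (contDiff_sigmaOneFactor (α := α) (t := t) (u := u))
    (Real.exp_pos _) hg
  obtain ⟨C₂, hC₂0, hC₂⟩ := exists_abs_log_sum_normIncBeta_sub_le (u := u) hα ht.antitone ht0
  obtain ⟨C₃, hC₃0, hC₃⟩ := exists_sum_envelope_le α
  refine ⟨C₁ + C₂ * C₃ + 1, by positivity, max 1 ⌈∑ ℓ, 2 * t ℓ⌉₊, fun n hn => ?_⟩
  have hn1 : 1 ≤ n := (le_max_left _ _).trans hn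
  have hnt : ∀ ℓ, 2 * t ℓ ≤ n := fun ℓ =>
    (Finset.single_le_sum (f := fun ℓ => 2 * t ℓ)
      (fun i _ => by have := ht0 i; positivity) (Finset.mem_univ ℓ)).trans
      ((Nat.le_ceil _).trans (by exact_mod_cast (le_max_right _ _).trans hn))
  have hn1' : (1:ℝ) ≤ n := by exact_mod_cast hn1
  have hn0 : (0:ℝ) < n := one_pos.trans_le hn1'
  set N := ⌈(n : ℝ) ^ (α / (2 + α))⌉₊ with hN
  have hN1 : 1 ≤ N := Nat.one_le_ceil_iff.2 (by positivity)
  have hNn : N ≤ n := Nat.ceil_le.2 <| by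
    have h := Real.rpow_le_rpow_of_exponent_le hn1'
      (show α / (2 + α) ≤ 1 by rw [div_le_one (by linarith)]; linarith)
    rwa [Real.rpow_one] at h
  have hN0 : (0:ℝ) < N := by exact_mod_cast hN1
  have hM : Mpar n α = ((N:ℝ) / n)⁻¹ := by rw [Mpar, ← hN, inv_div, div_eq_mul_inv]
  have ha : 0 < (N:ℝ) / n := by positivity
  have hMneg : ∀ s : ℝ, Mpar n α ^ (-s) = ((N:ℝ) / n) ^ s := fun s => by
    rw [hM, Real.inv_rpow ha.le, Real.rpow_neg ha.le, inv_inv]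
  have hMdiv : ∀ s : ℝ, (n:ℝ) / Mpar n α ^ s = n * ((N:ℝ) / n) ^ s := fun s => by
    rw [hM, Real.inv_rpow ha.le, div_inv_eq_mul]
  have hM1 : Mpar n α ^ (1 - α) = ((N:ℝ) / n) ^ (α - 1) := by
    rw [← hMneg, neg_sub]
  have hM0 : 1 / Mpar n α = (N:ℝ) / n := by rw [hM, one_div, inv_inv]
  have hsq : ∀ ℓ, Real.sqrt (1 - t ℓ / n) ^ 2 = 1 - t ℓ / n := fun ℓ =>
    Real.sq_sqrt (sub_nonneg.2 (div_le_one_of_le₀ (by linarith [hnt ℓ, ht0 ℓ]) hn0.le))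
  simp only [hsq]
  rw [hMneg, hMneg, hMdiv, hMdiv, hM1, hM0]
  have h1 := hC₁ n N hN1 hNn
  have hf₀ : ∀ x, 0 ≤ x → Real.log (weightedPrimitive α (OmegaTot u) (sigmaZeroDensity α t u) x)
      = fZero α t u x := fun x hx => by rw [fZero, one_add_SigmaZero hα ht0 hx]
  have hf₁ : ∀ x, 0 ≤ x → x ^ (α - 1) * sigmaOneFactor α t u x
      / weightedPrimitive α (OmegaTot u) (sigmaZeroDensity α t u) x = fOne α t u x := fun x hx => by
    rw [fOne, one_add_SigmaZero hα ht0 hx]; rfl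
  have hI₀ : ∫ x in (0:ℝ)..1,
      Real.log (weightedPrimitive α (OmegaTot u) (sigmaZeroDensity α t u) x)
      = ∫ x in (0:ℝ)..1, fZero α t u x :=
    intervalIntegral.integral_congr fun x hx => by
      rw [Set.uIcc_of_le zero_le_one] at hx
      exact hf₀ x hx.1
  have hI₁ : ∫ x in (0:ℝ)..1, x ^ (α - 1) * sigmaOneFactor α t u x
      / weightedPrimitive α (OmegaTot u) (sigmaZeroDensity α t u) x
      = ∫ x in (0:ℝ)..1, fOne α t u x :=
    intervalIntegral.integral_congr fun x hx => by
      rw [Set.uIcc_of_le zero_le_one] at hx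
      exact hf₁ x hx.1
  have hS : ∑ j ∈ Finset.Icc N n,
      (Real.log (weightedPrimitive α (OmegaTot u) (sigmaZeroDensity α t u) (j / n))
        + ((j:ℝ) / n) ^ (α - 1) * sigmaOneFactor α t u (j / n)
          / weightedPrimitive α (OmegaTot u) (sigmaZeroDensity α t u) (j / n) / n)
      = ∑ j ∈ Finset.Icc N n, (fZero α t u (j / n) + fOne α t u (j / n) / n) :=
    Finset.sum_congr rfl fun j _ => by rw [hf₀ _ (by positivity), hf₁ _ (by positivity)]
  rw [hI₀, hI₁, hS, hf₀ 1 zero_le_one, sigmaZeroDensity_zero, sigmaOneFactor_zero] at h1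
  have h2 : |∑ j ∈ Finset.Icc N n,
        Real.log (1 + ∑ ℓ, omegaCoef u ℓ * normIncBeta (1 - t ℓ / n) j α)
      - ∑ j ∈ Finset.Icc N n, (fZero α t u (j / n) + fOne α t u (j / n) / n)|
      ≤ C₂ * C₃ * ((1 + ((N:ℝ) / n) ^ (α - 1)) / n) := by
    rw [← Finset.sum_sub_distrib]
    refine (Finset.abs_sum_le_sum_abs _ _).trans ((Finset.sum_le_sum fun j hj => ?_).trans
      (show ∑ j ∈ Finset.Icc N n, C₂ * (envelope α ((j:ℝ) / n) / (n : ℝ) ^ 2) ≤ _ from ?_))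
    · rw [Finset.mem_Icc] at hj
      exact hC₂ n j hnt (hN1.trans hj.1) hj.2
    · rw [← Finset.mul_sum, ← Finset.sum_div]
      calc _ ≤ C₂ * (C₃ * (n * (1 + ((N:ℝ) / n) ^ (α - 1))) / (n:ℝ) ^ 2) := by
            gcongr; exact hC₃ n N hN1 hNn
        _ = _ := by field_simp
  have hG := Real.Gamma_pos_of_pos hα
  have hΩ : 0 < OmegaTot u := Real.exp_pos _
  have hG1 : Real.Gamma (α + 1) = α * Real.Gamma α := Real.Gamma_add_one hα.ne'
  have hG2 : Real.Gamma (α + 2) = (α + 1) * (α * Real.Gamma α) := by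
    rw [← hG1, ← Real.Gamma_add_one (by linarith), add_assoc, one_add_one_eq_two]
  have hα1 : α + 1 ≠ 0 := by linarith
  have k1 : -(Tzero α t u / Real.Gamma α) / (α * (α + 1) * OmegaTot u)
      = -(Tzero α t u / (OmegaTot u * Real.Gamma (α + 2))) := by
    rw [hG2]; field_simp
  have k2 : (-(Tzero α t u / Real.Gamma α) / 2 - Tzero α t u / Real.Gamma α * ((1 - α) / 2))
      / (α * OmegaTot u) = -((2 - α) * Tzero α t u / (2 * OmegaTot u * Real.Gamma (α + 1))) := by
    rw [hG1]; field_simp; ring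
  rw [k1, k2] at h1
  set X := (n:ℝ) * ((N:ℝ) / n) ^ (1 + 2 * α) + n * ((N:ℝ) / n) ^ (2 + α) with hX
  set Y := (1 + ((N:ℝ) / n) ^ (α - 1)) / (n:ℝ) with hY
  have hX0 : 0 ≤ X := by positivity
  have hY0 : 0 ≤ Y := by positivity
  have h3 := (abs_add_le _ _).trans (add_le_add h2 h1)
  refine le_trans (le_of_eq ?_) (h3.trans ?_)
  · congr 1
    ring
  · have : 0 ≤ C₂ * C₃ * X := by positivity
    linarith
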